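/- arXiv:1808.10386 — 2 statements merged into one kernel-verified Lean document; each statement's English description precedes it below -/
import Mathlib

section
/- Let u be a smooth axially symmetric solution of the stationary Navier–Stokes system (ASNS) with smooth axially symmetric pressure p, where u and p are defined on all of ℝ³ and are 2π-periodic in the vertical variable z, u(x) → 0 uniformly as r = |x'| → ∞, and the Dirichlet integral over one period is finite: ∫_{−π}^{π}∫₀^∞ |∇u|² r dr dz < ∞. Then u ≡ 0. -/
open MeasureTheory Real

/-- `∂_r f` for a function `f = f(r,z)`. -/
noncomputable def pdr (f : ℝ → ℝ → ℝ) (r z : ℝ) : ℝ := deriv (fun s => f s z) r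

/-- `∂_z f` for a function `f = f(r,z)`. -/
noncomputable def pdz (f : ℝ → ℝ → ℝ) (r z : ℝ) : ℝ := deriv (fun t => f r t) z

/-- The axially symmetric stationary Navier–Stokes system (ASNS), imposed for all
`r > 0` and all `z ∈ S`. -/
def ASNS (ur uθ uz p : ℝ → ℝ → ℝ) (S : Set ℝ) : Prop :=
  ∀ r : ℝ, 0 < r → ∀ z ∈ S,
    ((ur r z * pdr ur r z + uz r z * pdz ur r z) - (uθ r z) ^ 2 / r + pdr p r z
        = pdr (pdr ur) r z + (1 / r) * pdr ur r z + pdz (pdz ur) r z - ur r z / r ^ 2)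
    ∧ ((ur r z * pdr uθ r z + uz r z * pdz uθ r z) + ur r z * uθ r z / r
        = pdr (pdr uθ) r z + (1 / r) * pdr uθ r z + pdz (pdz uθ) r z - uθ r z / r ^ 2)
    ∧ ((ur r z * pdr uz r z + uz r z * pdz uz r z) + pdz p r z
        = pdr (pdr uz) r z + (1 / r) * pdr uz r z + pdz (pdz uz) r z)
    ∧ (pdr ur r z + ur r z / r + pdz uz r z = 0)

/-- The Dirichlet integrand `|∇u|²` of an axially symmetric field. -/
noncomputable def dirE (ur uθ uz : ℝ → ℝ → ℝ) (r z : ℝ) : ℝ :=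
  (pdr ur r z) ^ 2 + (pdz ur r z) ^ 2 + (pdr uθ r z) ^ 2 + (pdz uθ r z) ^ 2
    + (pdr uz r z) ^ 2 + (pdz uz r z) ^ 2 + ((ur r z) ^ 2 + (uθ r z) ^ 2) / r ^ 2


open Set Filter Topology

lemma hasDerivAt_pdr {f : ℝ → ℝ → ℝ} (hf : ContDiff ℝ (⊤ : ℕ∞) (fun q : ℝ × ℝ => f q.1 q.2))
    (r z : ℝ) : HasDerivAt (fun s => f s z) (pdr f r z) r := by
  have h : ContDiff ℝ (⊤ : ℕ∞) (fun s : ℝ => f s z) :=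
    hf.comp (contDiff_id.prodMk contDiff_const)
  exact (h.differentiable (by simp) r).hasDerivAt

lemma hasDerivAt_pdz {f : ℝ → ℝ → ℝ} (hf : ContDiff ℝ (⊤ : ℕ∞) (fun q : ℝ × ℝ => f q.1 q.2))
    (r z : ℝ) : HasDerivAt (fun t => f r t) (pdz f r z) z := by
  have h : ContDiff ℝ (⊤ : ℕ∞) (fun t : ℝ => f r t) :=
    hf.comp (contDiff_const.prodMk contDiff_id)
  exact (h.differentiable (by simp) z).hasDerivAt

lemma contDiff_pdr {f : ℝ → ℝ → ℝ} (hf : ContDiff ℝ (⊤ : ℕ∞) (fun q : ℝ × ℝ => f q.1 q.2)) :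
    ContDiff ℝ (⊤ : ℕ∞) (fun q : ℝ × ℝ => pdr f q.1 q.2) := by
  have h : (fun q : ℝ × ℝ => pdr f q.1 q.2)
      = fun q : ℝ × ℝ => fderiv ℝ (fun q : ℝ × ℝ => f q.1 q.2) q (1, 0) := by
    funext q
    have h1 := (hf.differentiable (by simp) q).hasFDerivAt
    have h2 : HasDerivAt (fun s : ℝ => (s, q.2)) ((1 : ℝ), (0 : ℝ)) q.1 :=
      (hasDerivAt_id q.1).prodMk (hasDerivAt_const q.1 q.2)
    exact (h1.comp_hasDerivAt (f := fun s : ℝ => (s, q.2)) q.1 h2).deriv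
  rw [h]
  exact (hf.fderiv_right (m := (⊤ : ℕ∞)) (by simp)).clm_apply contDiff_const

lemma contDiff_pdz {f : ℝ → ℝ → ℝ} (hf : ContDiff ℝ (⊤ : ℕ∞) (fun q : ℝ × ℝ => f q.1 q.2)) :
    ContDiff ℝ (⊤ : ℕ∞) (fun q : ℝ × ℝ => pdz f q.1 q.2) := by
  have h : (fun q : ℝ × ℝ => pdz f q.1 q.2)
      = fun q : ℝ × ℝ => fderiv ℝ (fun q : ℝ × ℝ => f q.1 q.2) q (0, 1) := by
    funext q
    have h1 := (hf.differentiable (by simp) q).hasFDerivAt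
    have h2 : HasDerivAt (fun s : ℝ => (q.1, s)) ((0 : ℝ), (1 : ℝ)) q.2 :=
      (hasDerivAt_const q.2 q.1).prodMk (hasDerivAt_id q.2)
    exact (h1.comp_hasDerivAt (f := fun s : ℝ => (q.1, s)) q.2 h2).deriv
  rw [h]
  exact (hf.fderiv_right (m := (⊤ : ℕ∞)) (by simp)).clm_apply contDiff_const

lemma pdz_per {f : ℝ → ℝ → ℝ} (h : ∀ r z : ℝ, f r (z + 2 * π) = f r z) (r z : ℝ) :
    pdz f r (z + 2 * π) = pdz f r z := by
  unfold pdz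
  rw [← deriv_comp_add_const]
  simp only [h]

lemma per_pi {f : ℝ → ℝ → ℝ} (h : ∀ r z : ℝ, f r (z + 2 * π) = f r z) (r : ℝ) :
    f r π = f r (-π) := by
  rw [← h r (-π)]; congr 1; ring

/-- Differentiation under the integral sign. -/
lemma hasDerivAt_int {F F' : ℝ → ℝ → ℝ} (hF : Continuous (fun q : ℝ × ℝ => F q.1 q.2))
    (hF' : Continuous (fun q : ℝ × ℝ => F' q.1 q.2))
    (hd : ∀ r z, HasDerivAt (fun s => F s z) (F' r z) r) (a b r : ℝ) :
    HasDerivAt (fun s => ∫ z in a..b, F s z) (∫ z in a..b, F' r z) r := by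
  obtain ⟨C, hC⟩ := ((isCompact_closedBall r 1).prod (isCompact_uIcc (a := a) (b := b))).exists_bound_of_continuousOn
    hF'.continuousOn
  refine (intervalIntegral.hasDerivAt_integral_of_dominated_loc_of_deriv_le
    (bound := fun _ => C) (Metric.ball_mem_nhds r one_pos) ?_ ?_ ?_ ?_ ?_ ?_).2
  · refine Eventually.of_forall fun s => ?_
    exact (Continuous.aestronglyMeasurable (by fun_prop))
  · exact Continuous.intervalIntegrable (by fun_prop) _ _
  · exact (Continuous.aestronglyMeasurable (by fun_prop))
  · refine Eventually.of_forall fun z hz s hs => ?_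
    exact hC (s, z) ⟨Metric.ball_subset_closedBall hs, uIoc_subset_uIcc hz⟩
  · exact intervalIntegrable_const
  · exact Eventually.of_forall fun z _ s _ => hd s z

lemma cont_int {F : ℝ → ℝ → ℝ} (hF : Continuous (fun q : ℝ × ℝ => F q.1 q.2)) (a : ℝ) :
    Continuous (fun q : ℝ × ℝ => ∫ z in a..q.2, F q.1 z) := by
  have := intervalIntegral.continuous_parametric_primitive_of_continuous (μ := volume) (a₀ := a) (f := F) hF
  exact this

/-- Cauchy–Schwarz for primitives on `[-π, π]`. -/
lemma sq_prim_le {f : ℝ → ℝ} (hf : Continuous f) {z : ℝ} (hz : z ∈ Icc (-π) π) :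
    (∫ t in (-π)..z, f t) ^ 2 ≤ 2 * π * ∫ t in (-π)..π, f t ^ 2 := by
  have hpi := Real.pi_pos
  set J := ∫ t in (-π)..z, f t with hJ
  have h1 : ∫ t in (-π)..z, f t ^ 2 ≤ ∫ t in (-π)..π, f t ^ 2 := by
    refine intervalIntegral.integral_mono_interval le_rfl hz.1 hz.2 ?_ ?_
    · exact Eventually.of_forall fun t => sq_nonneg _
    · exact Continuous.intervalIntegrable (by fun_prop) _ _
  have h2 : 0 ≤ ∫ t in (-π)..z, (f t - J / (2 * π)) ^ 2 :=
    intervalIntegral.integral_nonneg hz.1 fun t _ => sq_nonneg _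
  have h3 : ∫ t in (-π)..z, (f t - J / (2 * π)) ^ 2
      = (∫ t in (-π)..z, f t ^ 2) - 2 * (J / (2 * π)) * J + (z + π) * (J / (2 * π)) ^ 2 := by
    have : ∀ t, (f t - J / (2 * π)) ^ 2
        = f t ^ 2 - 2 * (J / (2 * π)) * f t + (J / (2 * π)) ^ 2 := fun t => by ring
    simp only [this]
    rw [intervalIntegral.integral_add, intervalIntegral.integral_sub,
      intervalIntegral.integral_const_mul, intervalIntegral.integral_const, smul_eq_mul]
    · ring
    all_goals exact Continuous.intervalIntegrable (by fun_prop) _ _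
  have h4 : (z + π) * (J / (2 * π)) ^ 2 ≤ (2 * π) * (J / (2 * π)) ^ 2 := by
    gcongr; linarith [hz.2]
  have h5 : 2 * (J / (2 * π)) * J = 2 * (J ^ 2 / (2 * π)) := by ring
  have h6 : (2 * π) * (J / (2 * π)) ^ 2 = J ^ 2 / (2 * π) := by field_simp
  have h7 : J ^ 2 / (2 * π) ≤ ∫ t in (-π)..π, f t ^ 2 := by linarith
  rw [div_le_iff₀ (by positivity)] at h7
  linarith

lemma int_sq_prim_le {f : ℝ → ℝ} (hf : Continuous f) :
    ∫ z in (-π)..π, (∫ t in (-π)..z, f t) ^ 2 ≤ (2 * π) ^ 2 * ∫ t in (-π)..π, f t ^ 2 := by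
  have hpi := Real.pi_pos
  have hc : Continuous fun z => ∫ t in (-π)..z, f t :=
    intervalIntegral.continuous_primitive (fun a b => hf.intervalIntegrable a b) _
  calc ∫ z in (-π)..π, (∫ t in (-π)..z, f t) ^ 2
      ≤ ∫ z in (-π)..π, (2 * π * ∫ t in (-π)..π, f t ^ 2) := by
        refine intervalIntegral.integral_mono_on (by linarith) ?_ ?_ fun z hz => sq_prim_le hf hz
        all_goals exact Continuous.intervalIntegrable (by fun_prop) _ _
    _ = _ := by rw [intervalIntegral.integral_const, smul_eq_mul]; ring

/-- Integration by parts against the primitive of a mean-zero function. -/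
lemma ibp_prim {f g g' : ℝ → ℝ} (hf : Continuous f) (hg : ∀ z, HasDerivAt g (g' z) z)
    (hg' : Continuous g') (h0 : ∫ t in (-π)..π, f t = 0) :
    ∫ z in (-π)..π, f z * g z = - ∫ z in (-π)..π, (∫ t in (-π)..z, f t) * g' z := by
  have hU : ∀ z, HasDerivAt (fun z => ∫ t in (-π)..z, f t) (f z) z := fun z =>
    intervalIntegral.integral_hasDerivAt_right (hf.intervalIntegrable _ _)
      (hf.stronglyMeasurableAtFilter _ _) hf.continuousAt
  have := intervalIntegral.integral_mul_deriv_eq_deriv_mul (a := -π) (b := π)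
    (fun z _ => hU z) (fun z _ => hg z) (hf.intervalIntegrable _ _) (hg'.intervalIntegrable _ _)
  rw [this, h0]; simp

/-- Poincaré inequality. -/
lemma poincare {f f' : ℝ → ℝ} (hf : ∀ z, HasDerivAt f (f' z) z) (hf' : Continuous f')
    (h0 : ∫ t in (-π)..π, f t = 0) :
    ∫ z in (-π)..π, f z ^ 2 ≤ (2 * π) ^ 2 * ∫ z in (-π)..π, f' z ^ 2 := by
  have hpi := Real.pi_pos
  have hc : Continuous f := continuous_iff_continuousAt.2 fun z => (hf z).continuousAt
  have hcU : Continuous fun z => ∫ t in (-π)..z, f t :=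
    intervalIntegral.continuous_primitive (fun a b => hc.intervalIntegrable a b) _
  have h1 := ibp_prim hc hf hf' h0
  have h2 := int_sq_prim_le hc
  set P : ℝ := (2 * π) ^ 2 with hP
  have hPp : 0 < P := by positivity
  have h3 : - ∫ z in (-π)..π, (∫ t in (-π)..z, f t) * f' z
      ≤ ∫ z in (-π)..π, (1 / (2 * P) * (∫ t in (-π)..z, f t) ^ 2 + P / 2 * f' z ^ 2) := by
    rw [← intervalIntegral.integral_neg]
    refine intervalIntegral.integral_mono_on (by linarith) ?_ ?_ fun z hz => ?_
    · exact Continuous.intervalIntegrable (by fun_prop) _ _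
    · exact Continuous.intervalIntegrable (by fun_prop) _ _
    · set J := ∫ t in (-π)..z, f t
      have : 1 / (2 * P) * J ^ 2 + P / 2 * f' z ^ 2 + J * f' z = (J + P * f' z) ^ 2 / (2 * P) := by
        field_simp; ring
      have : 0 ≤ (J + P * f' z) ^ 2 / (2 * P) := by positivity
      linarith
  rw [intervalIntegral.integral_add, intervalIntegral.integral_const_mul,
    intervalIntegral.integral_const_mul] at h3
  · have h4 : ∫ z in (-π)..π, f z * f z = ∫ z in (-π)..π, f z ^ 2 := by
      congr 1; funext z; ring
    rw [h4] at h1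
    have h5 : 1 / (2 * P) * ∫ z in (-π)..π, (∫ t in (-π)..z, f t) ^ 2
        ≤ 1 / (2 * P) * (P * ∫ t in (-π)..π, f t ^ 2) := by gcongr
    have h6 : 1 / (2 * P) * (P * ∫ t in (-π)..π, f t ^ 2) = 1 / 2 * ∫ t in (-π)..π, f t ^ 2 := by
      field_simp
    linarith
  all_goals exact Continuous.intervalIntegrable (by fun_prop) _ _

lemma finish {G D n n' : ℝ → ℝ} {R0 C K K' : ℝ} (hR0 : 1 ≤ R0) (hC : 0 ≤ C)
    (hGc : Continuous G) (hG0 : G 0 = 0)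
    (hG : ∀ r, 0 < r → HasDerivAt G (r * D r) r) (hD : ∀ r, 0 < r → 0 ≤ D r)
    (hn : ∀ r, HasDerivAt n (n' r) r)
    (hin : ∀ r, R0 ≤ r → G r / r ≤ n' r + C * D r)
    (hnb : ∀ r, R0 ≤ r → n r ≤ K + C * D r)
    (hGb : ∀ r, R0 ≤ r → G r ≤ K') : ∀ r, 0 < r → D r = 0 := by
  have hmono : MonotoneOn G (Ici 0) := by
    refine monotoneOn_of_hasDerivWithinAt_nonneg (f' := fun r => r * D r) (convex_Ici 0)
      hGc.continuousOn ?_ ?_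
    · intro x hx
      rw [interior_Ici] at hx
      exact (hG x hx).hasDerivWithinAt
    · intro x hx
      rw [interior_Ici] at hx
      exact mul_nonneg (le_of_lt hx) (hD x hx)
  have hGzero : ∀ r, 0 ≤ r → G r = 0 := by
    intro a0 ha0
    by_contra hne
    have hpos : 0 < G a0 := by
      refine lt_of_le_of_ne ?_ (Ne.symm hne)
      rw [← hG0]; exact hmono (mem_Ici.2 le_rfl) ha0 ha0
    set a := max a0 R0 with ha
    have haR : R0 ≤ a := le_max_right _ _
    have ha1 : 1 ≤ a := hR0.trans haR
    set c := G a with hc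
    have hcpos : 0 < c := lt_of_lt_of_le hpos (hmono ha0 (mem_Ici.2 (by linarith)) (le_max_left _ _))
    have hM : MonotoneOn (fun r => n r + C * G r - c * log r) (Ici a) := by
      refine monotoneOn_of_hasDerivWithinAt_nonneg
        (f' := fun r => n' r + C * (r * D r) - c * r⁻¹) (convex_Ici a) ?_ ?_ ?_
      · intro x hx
        have hx0 : 0 < x := by have := mem_Ici.1 hx; linarith
        exact (((hn x).add ((hG x hx0).const_mul C)).sub
          ((Real.hasDerivAt_log hx0.ne').const_mul c)).continuousAt.continuousWithinAt
      · intro x hx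
        rw [interior_Ici] at hx
        have hx0 : 0 < x := by have := mem_Ioi.1 hx; linarith
        exact (((hn x).add ((hG x hx0).const_mul C)).sub
          ((Real.hasDerivAt_log hx0.ne').const_mul c)).hasDerivWithinAt
      · intro x hx
        rw [interior_Ici] at hx
        have hxa : a < x := hx
        have hx0 : 0 < x := by linarith
        have h1 := hin x (by linarith)
        have h2 : c / x ≤ G x / x := by
          gcongr
          exact hmono (mem_Ici.2 (by linarith)) (mem_Ici.2 hx0.le) hxa.le
        have h3 : C * D x ≤ C * (x * D x) := by
          gcongr
          have := hD x hx0
          nlinarith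
        rw [div_eq_mul_inv] at h2
        linarith
    set m := n a + C * G a - c * log a with hm
    have hlow : ∀ r, a ≤ r → c * log r + m - K - C * K' ≤ C * D r := by
      intro r hr
      have h1 := hM (mem_Ici.2 le_rfl) (mem_Ici.2 hr) hr
      simp only at h1
      have h2 := hnb r (haR.trans hr)
      have h3 : C * G r ≤ C * K' := by gcongr; exact hGb r (haR.trans hr)
      linarith
    have htend : Tendsto (fun r => c * log r) atTop atTop :=
      Real.tendsto_log_atTop.const_mul_atTop hcpos
    obtain ⟨b, hb⟩ := (eventually_atTop.1 (htend.eventually_ge_atTop (C + 1 + K + C * K' - m)))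
    set b' := max a b with hb'
    have hDge : ∀ r, b' ≤ r → 1 ≤ D r := by
      intro r hr
      have h1 := hb r ((le_max_right _ _).trans hr)
      have h2 := hlow r ((le_max_left _ _).trans hr)
      by_contra hlt
      push Not at hlt
      nlinarith
    have hM2 : MonotoneOn (fun r => G r - r) (Ici b') := by
      refine monotoneOn_of_hasDerivWithinAt_nonneg
        (f' := fun r => r * D r - 1) (convex_Ici b') (by fun_prop) ?_ ?_
      · intro x hx
        rw [interior_Ici] at hx
        have hx0 : 0 < x := by
          have := mem_Ioi.1 hx
          have := le_max_left a b
          linarith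
        exact ((hG x hx0).sub (hasDerivAt_id x)).hasDerivWithinAt
      · intro x hx
        rw [interior_Ici] at hx
        have hx1 : 1 ≤ x := by
          have := mem_Ioi.1 hx
          have := le_max_left a b
          linarith
        have := hDge x (le_of_lt hx)
        nlinarith
    have hab := le_max_left a b
    set s := b' + |K'| + |G b'| + 1 with hs
    have hsb : b' ≤ s := by have := abs_nonneg K'; have := abs_nonneg (G b'); linarith
    have h1 := hM2 (mem_Ici.2 le_rfl) (mem_Ici.2 hsb) hsb
    simp only at h1
    have h2 := hGb s (by linarith)
    have := le_abs_self K'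
    have := neg_abs_le (G b')
    linarith
  intro r hr
  have h1 : HasDerivAt G 0 r := by
    refine (hasDerivAt_const r (0 : ℝ)).congr_of_eventuallyEq ?_
    filter_upwards [lt_mem_nhds hr] with x hx using hGzero x hx.le
  have := (hG r hr).unique h1
  rcases mul_eq_zero.1 this with h | h
  · linarith
  · exact h

set_option maxHeartbeats 4000000 in
/-- A smooth axially symmetric solution of ASNS on `ℝ³`, `2π`-periodic in
`z`, vanishing uniformly as `r → ∞`, with finite Dirichlet integral over one period,
is identically zero. -/
theorem vanishing_of_periodic_axisymmetric_D_solution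
    (ur uθ uz p : ℝ → ℝ → ℝ)
    (hur : ContDiff ℝ (⊤ : ℕ∞) (fun q : ℝ × ℝ => ur q.1 q.2))
    (huθ : ContDiff ℝ (⊤ : ℕ∞) (fun q : ℝ × ℝ => uθ q.1 q.2))
    (huz : ContDiff ℝ (⊤ : ℕ∞) (fun q : ℝ × ℝ => uz q.1 q.2))
    (hp : ContDiff ℝ (⊤ : ℕ∞) (fun q : ℝ × ℝ => p q.1 q.2))
    (hper : ∀ r z : ℝ, ur r (z + 2 * π) = ur r z ∧ uθ r (z + 2 * π) = uθ r z
      ∧ uz r (z + 2 * π) = uz r z ∧ p r (z + 2 * π) = p r z)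
    (heq : ASNS ur uθ uz p Set.univ)
    (hdecay : ∀ ε : ℝ, 0 < ε → ∃ R : ℝ, ∀ r : ℝ, R ≤ r → ∀ z : ℝ,
      |ur r z| + |uθ r z| + |uz r z| < ε)
    (hdir : ∫⁻ q in Set.Ioi (0:ℝ) ×ˢ Set.Icc (-π) π,
      ENNReal.ofReal (dirE ur uθ uz q.1 q.2 * q.1) < ⊤) :
    ∀ r : ℝ, 0 ≤ r → ∀ z : ℝ, ur r z = 0 ∧ uθ r z = 0 ∧ uz r z = 0 := by
  have hpi := Real.pi_pos
  have hpp : -π ≤ π := by linarith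
  -- smoothness of derivatives
  have sAr := contDiff_pdr hur
  have sAz := contDiff_pdz hur
  have sTr := contDiff_pdr huθ
  have sTz := contDiff_pdz huθ
  have sZr := contDiff_pdr huz
  have sZz := contDiff_pdz huz
  have cA := hur.continuous
  have cT := huθ.continuous
  have cZ := huz.continuous
  have cp := hp.continuous
  have cAr := sAr.continuous
  have cAz := sAz.continuous
  have cTr := sTr.continuous
  have cTz := sTz.continuous
  have cZr := sZr.continuous
  have cZz := sZz.continuous
  have cpr := (contDiff_pdr hp).continuous
  have cpz := (contDiff_pdz hp).continuous
  have cArr := (contDiff_pdr sAr).continuous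
  have cAzz := (contDiff_pdz sAz).continuous
  have cTrr := (contDiff_pdr sTr).continuous
  have cTzz := (contDiff_pdz sTz).continuous
  have cZrr := (contDiff_pdr sZr).continuous
  have cZzz := (contDiff_pdz sZz).continuous
  have pA := fun r z => (hper r z).1
  have pT := fun r z => (hper r z).2.1
  have pZ := fun r z => (hper r z).2.2.1
  have pp := fun r z => (hper r z).2.2.2
  -- continuity of the weighted Dirichlet integrand in z
  have cE : ∀ r, Continuous (fun z => dirE ur uθ uz r z) := by
    intro r
    unfold dirE
    simp only [div_eq_mul_inv]
    fun_prop
  have nE : ∀ r z, 0 ≤ dirE ur uθ uz r z := by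
    intro r z; unfold dirE; positivity
  -- zero mean of ur
  have hmean : ∀ r, 0 < r → ∫ z in (-π)..π, ur r z = 0 := by
    have hder : ∀ r, HasDerivAt (fun s => ∫ z in (-π)..π, s * ur s z)
        (∫ z in (-π)..π, (1 * ur r z + r * pdr ur r z)) r := by
      intro r
      refine hasDerivAt_int (F := fun s z => s * ur s z)
        (F' := fun r z => 1 * ur r z + r * pdr ur r z) (by fun_prop) (by fun_prop) ?_ _ _ r
      intro r z
      exact (hasDerivAt_id r).mul (hasDerivAt_pdr hur r z)
    have hz : ∀ r, 0 < r → ∫ z in (-π)..π, (1 * ur r z + r * pdr ur r z) = 0 := by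
      intro r hr
      have h1 : ∀ z, 1 * ur r z + r * pdr ur r z = - r * pdz uz r z := by
        intro z
        have h := (heq r hr z (Set.mem_univ z)).2.2.2
        field_simp at h
        linarith
      simp only [h1]
      rw [intervalIntegral.integral_const_mul,
        intervalIntegral.integral_eq_sub_of_hasDerivAt (f := fun z => uz r z)
          (fun z _ => hasDerivAt_pdz huz r z)
          (Continuous.intervalIntegrable (by fun_prop) _ _), per_pi pZ]
      ring
    have hcont : Continuous (fun s => ∫ z in (-π)..π, s * ur s z) :=
      continuous_iff_continuousAt.2 fun r => (hder r).continuousAt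
    intro r hr
    have hk := constant_of_has_deriv_right_zero (f := fun s => ∫ z in (-π)..π, s * ur s z)
      (a := 0) (b := r) hcont.continuousOn (fun x hx => by
        rcases hx.1.eq_or_lt with h | h
        · subst h
          have h2 : (∫ z in (-π)..π, (1 * ur 0 z + 0 * pdr ur 0 z)) = 0 := by
            have hc2 : Continuous (fun r => ∫ z in (-π)..π, (1 * ur r z + r * pdr ur r z)) :=
              intervalIntegral.continuous_parametric_intervalIntegral_of_continuous' (by
                simp only [Function.uncurry_def]; fun_prop) _ _
            have t1 := (hc2.tendsto 0).mono_left (nhdsWithin_le_nhds (s := Set.Ioi 0))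
            have t2 : Tendsto (fun r => ∫ z in (-π)..π, (1 * ur r z + r * pdr ur r z))
                (𝓝[>] 0) (𝓝 0) := by
              refine tendsto_const_nhds.congr' ?_
              filter_upwards [self_mem_nhdsWithin] with r hr using (hz r hr).symm
            exact tendsto_nhds_unique t1 t2
          exact (hder 0).hasDerivWithinAt.congr_deriv h2
        · rw [← hz x h]
          exact (hder x).hasDerivWithinAt) r ⟨hr.le, le_rfl⟩
    simp only [zero_mul, intervalIntegral.integral_zero,
      intervalIntegral.integral_const_mul] at hk
    rcases mul_eq_zero.1 hk with h | h
    · linarith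
    · exact h
  -- the energy flux
  set g : ℝ → ℝ → ℝ := fun r z => ur r z * pdr ur r z + uθ r z * pdr uθ r z + uz r z * pdr uz r z
    - ur r z * ((ur r z ^ 2 + uθ r z ^ 2 + uz r z ^ 2) / 2 + p r z) with hg
  set gr : ℝ → ℝ → ℝ := fun r z =>
    (pdr ur r z * pdr ur r z + ur r z * pdr (pdr ur) r z)
    + (pdr uθ r z * pdr uθ r z + uθ r z * pdr (pdr uθ) r z)
    + (pdr uz r z * pdr uz r z + uz r z * pdr (pdr uz) r z)
    - (pdr ur r z * ((ur r z ^ 2 + uθ r z ^ 2 + uz r z ^ 2) / 2 + p r z)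
      + ur r z * (ur r z * pdr ur r z + uθ r z * pdr uθ r z + uz r z * pdr uz r z
        + pdr p r z)) with hgr
  have cg : Continuous (fun q : ℝ × ℝ => g q.1 q.2) := by simp only [hg]; fun_prop
  have cgr : Continuous (fun q : ℝ × ℝ => gr q.1 q.2) := by simp only [hgr]; fun_prop
  have dg : ∀ r z, HasDerivAt (fun s => g s z) (gr r z) r := by
    intro r z
    have a1 := hasDerivAt_pdr hur r z
    have a2 := hasDerivAt_pdr sAr r z
    have t1 := hasDerivAt_pdr huθ r z
    have t2 := hasDerivAt_pdr sTr r z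
    have z1 := hasDerivAt_pdr huz r z
    have z2 := hasDerivAt_pdr sZr r z
    have p1 := hasDerivAt_pdr hp r z
    have := (((a1.mul a2).add (t1.mul t2)).add (z1.mul z2)).sub
      (a1.mul (((((a1.pow 2).add (t1.pow 2)).add (z1.pow 2)).div_const 2).add p1))
    refine this.congr_deriv ?_
    simp only [hgr, Pi.pow_apply, Pi.add_apply]
    push_cast
    ring
  set G : ℝ → ℝ := fun r => ∫ z in (-π)..π, r * g r z with hGdef
  set D : ℝ → ℝ := fun r => ∫ z in (-π)..π, dirE ur uθ uz r z with hDdef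
  have hGd : ∀ r, HasDerivAt G (∫ z in (-π)..π, (1 * g r z + r * gr r z)) r := by
    intro r
    refine hasDerivAt_int (F := fun s z => s * g s z)
      (F' := fun r z => 1 * g r z + r * gr r z) (by fun_prop) (by fun_prop) ?_ _ _ r
    intro r z
    exact (hasDerivAt_id r).mul (dg r z)
  have hGc : Continuous G := continuous_iff_continuousAt.2 fun r => (hGd r).continuousAt
  have hG0 : G 0 = 0 := by simp [hGdef]
  have hDnn : ∀ r, 0 ≤ D r := fun r =>
    intervalIntegral.integral_nonneg hpp fun z _ => nE r z
  have hGD : ∀ r, 0 < r → ∫ z in (-π)..π, (1 * g r z + r * gr r z) = r * D r := by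
    intro r hr
    set k : ℝ → ℝ := fun z => r * (uz r z * ((ur r z ^ 2 + uθ r z ^ 2 + uz r z ^ 2) / 2 + p r z)
      - (ur r z * pdz ur r z + uθ r z * pdz uθ r z + uz r z * pdz uz r z)) with hk
    set k' : ℝ → ℝ := fun z => r * ((pdz uz r z *
        ((ur r z ^ 2 + uθ r z ^ 2 + uz r z ^ 2) / 2 + p r z)
      + uz r z * (ur r z * pdz ur r z + uθ r z * pdz uθ r z + uz r z * pdz uz r z + pdz p r z))
      - ((pdz ur r z * pdz ur r z + ur r z * pdz (pdz ur) r z)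
        + (pdz uθ r z * pdz uθ r z + uθ r z * pdz (pdz uθ) r z)
        + (pdz uz r z * pdz uz r z + uz r z * pdz (pdz uz) r z))) with hk'
    have dk : ∀ z, HasDerivAt k (k' z) z := by
      intro z
      have a1 := hasDerivAt_pdz hur r z
      have a2 := hasDerivAt_pdz sAz r z
      have t1 := hasDerivAt_pdz huθ r z
      have t2 := hasDerivAt_pdz sTz r z
      have z1 := hasDerivAt_pdz huz r z
      have z2 := hasDerivAt_pdz sZz r z
      have p1 := hasDerivAt_pdz hp r z
      have := ((z1.mul (((((a1.pow 2).add (t1.pow 2)).add (z1.pow 2)).div_const 2).add p1)).sub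
        (((a1.mul a2).add (t1.mul t2)).add (z1.mul z2))).const_mul r
      refine this.congr_deriv ?_
      simp only [hk', Pi.pow_apply, Pi.add_apply]
      push_cast
      ring
    have ck' : Continuous k' := by simp only [hk']; fun_prop
    have hpt : ∀ z, 1 * g r z + r * gr r z = r * dirE ur uθ uz r z + k' z := by
      intro z
      obtain ⟨e1, e2, e3, e4⟩ := heq r hr z (Set.mem_univ z)
      simp only [hg, hgr, hk', dirE]
      generalize pdr (pdr ur) r z = Arr at *
      generalize pdr (pdr uθ) r z = Trr at *
      generalize pdr (pdr uz) r z = Zrr at *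
      generalize pdz (pdz ur) r z = Azz at *
      generalize pdz (pdz uθ) r z = Tzz at *
      generalize pdz (pdz uz) r z = Zzz at *
      generalize pdr ur r z = Ar at *
      generalize pdr uθ r z = Tr at *
      generalize pdr uz r z = Zr at *
      generalize pdz ur r z = Az at *
      generalize pdz uθ r z = Tz at *
      generalize pdz uz r z = Zz at *
      generalize pdr p r z = pr at *
      generalize pdz p r z = pz at *
      generalize ur r z = A at *
      generalize uθ r z = T at *
      generalize uz r z = Z at *
      generalize p r z = P at *
      have hrr : r ≠ 0 := hr.ne'
      have e4' : Zz = -(Ar + A / r) := by linarith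
      have e1' : Arr = A * Ar + Z * Az - T ^ 2 / r + pr - (1 / r) * Ar - Azz + A / r ^ 2 := by
        linarith
      have e2' : Trr = A * Tr + Z * Tz + A * T / r - (1 / r) * Tr - Tzz + T / r ^ 2 := by
        linarith
      have e3' : Zrr = A * Zr + Z * Zz + pz - (1 / r) * Zr - Zzz := by linarith
      rw [e1', e2', e3', e4']
      field_simp
      ring
    simp only [hpt]
    rw [intervalIntegral.integral_add ((cE r).const_mul r |>.intervalIntegrable _ _)
      (ck'.intervalIntegrable _ _), intervalIntegral.integral_const_mul,
      intervalIntegral.integral_eq_sub_of_hasDerivAt (fun z _ => dk z)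
        (ck'.intervalIntegrable _ _)]
    have : k π = k (-π) := by
      simp only [hk, per_pi pA, per_pi pT, per_pi pZ, per_pi pp, per_pi (pdz_per pA),
        per_pi (pdz_per pT), per_pi (pdz_per pZ)]
    rw [this]; simp [hDdef]
  have hG : ∀ r, 0 < r → HasDerivAt G (r * D r) r := fun r hr => hGD r hr ▸ hGd r
  -- the Dirichlet bound for G
  have hDnn' : ∀ r, 0 < r → 0 ≤ r * D r := fun r hr => mul_nonneg hr.le (hDnn r)
  set I := ∫⁻ q in Set.Ioi (0:ℝ) ×ˢ Set.Icc (-π) π,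
      ENNReal.ofReal (dirE ur uθ uz q.1 q.2 * q.1) with hI
  have hGb : ∀ r, 1 ≤ r → G r ≤ G 1 + I.toReal := by
    intro R hR
    have cG' : Continuous (fun r => ∫ z in (-π)..π, (1 * g r z + r * gr r z)) :=
      intervalIntegral.continuous_parametric_intervalIntegral_of_continuous' (by
        simp only [Function.uncurry_def]; fun_prop) _ _
    have h1 : ∫ r in (1:ℝ)..R, (∫ z in (-π)..π, (1 * g r z + r * gr r z)) = G R - G 1 :=
      intervalIntegral.integral_eq_sub_of_hasDerivAt (fun r _ => hGd r)
        (cG'.intervalIntegrable _ _)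
    have hnn : ∀ r ∈ Set.Ioc 1 R, 0 ≤ ∫ z in (-π)..π, (1 * g r z + r * gr r z) := by
      intro r hr
      have : (0:ℝ) < r := by linarith [hr.1]
      rw [hGD r this]; exact hDnn' r this
    have h2 : ENNReal.ofReal (G R - G 1) ≤ I := by
      rw [← h1, intervalIntegral.integral_of_le hR, ofReal_integral_eq_lintegral_ofReal
        (cG'.integrableOn_Ioc) (by
          filter_upwards [ae_restrict_mem measurableSet_Ioc] with r hr using hnn r hr)]
      have hmeas : Measurable (fun q : ℝ × ℝ => ENNReal.ofReal (dirE ur uθ uz q.1 q.2 * q.1)) := by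
        have := cA.measurable
        have := cT.measurable
        have := cAr.measurable
        have := cAz.measurable
        have := cTr.measurable
        have := cTz.measurable
        have := cZr.measurable
        have := cZz.measurable
        unfold dirE
        fun_prop
      calc ∫⁻ r in Set.Ioc 1 R, ENNReal.ofReal (∫ z in (-π)..π, (1 * g r z + r * gr r z))
          = ∫⁻ r in Set.Ioc 1 R, ∫⁻ z in Set.Icc (-π) π,
              ENNReal.ofReal (dirE ur uθ uz r z * r) := by
            refine setLIntegral_congr_fun measurableSet_Ioc fun r hr => ?_
            have hr0 : (0:ℝ) < r := by linarith [hr.1]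
            rw [hGD r hr0, mul_comm, hDdef]
            rw [← intervalIntegral.integral_mul_const, intervalIntegral.integral_of_le hpp,
              ← integral_Icc_eq_integral_Ioc, ofReal_integral_eq_lintegral_ofReal]
            · exact ((cE r).mul_const r).integrableOn_Icc
            · exact Eventually.of_forall fun z => mul_nonneg (nE r z) hr0.le
        _ = ∫⁻ q in Set.Ioc (1:ℝ) R ×ˢ Set.Icc (-π) π,
              ENNReal.ofReal (dirE ur uθ uz q.1 q.2 * q.1) := by
            rw [Measure.volume_eq_prod, ← Measure.prod_restrict,
              lintegral_prod _ hmeas.aemeasurable]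
        _ ≤ I := by
            refine lintegral_mono_set (Set.prod_mono ?_ le_rfl)
            intro r hr
            exact lt_trans one_pos hr.1
    have h3 := (ENNReal.ofReal_le_iff_le_toReal hdir.ne).1 h2
    linarith
  -- the corrector
  set U : ℝ → ℝ → ℝ := fun r z => ∫ t in (-π)..z, ur r t with hU
  set V : ℝ → ℝ → ℝ := fun r z => ∫ t in (-π)..z, pdr ur r t with hV
  have cU : Continuous (fun q : ℝ × ℝ => U q.1 q.2) := cont_int cA _
  have cV : Continuous (fun q : ℝ × ℝ => V q.1 q.2) := cont_int cAr _
  have dU : ∀ r z, HasDerivAt (fun s => U s z) (V r z) r := fun r z =>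
    hasDerivAt_int cA cAr (hasDerivAt_pdr hur) _ _ r
  set n : ℝ → ℝ := fun r => ∫ z in (-π)..π,
    ((ur r z ^ 2 + uθ r z ^ 2 + uz r z ^ 2) / 2 + U r z * pdr uz r z) with hn
  set n' : ℝ → ℝ := fun r => ∫ z in (-π)..π,
    ((ur r z * pdr ur r z + uθ r z * pdr uθ r z + uz r z * pdr uz r z)
      + (V r z * pdr uz r z + U r z * pdr (pdr uz) r z)) with hn'
  have dn : ∀ r, HasDerivAt n (n' r) r := by
    intro r
    refine hasDerivAt_int
      (F := fun r z => (ur r z ^ 2 + uθ r z ^ 2 + uz r z ^ 2) / 2 + U r z * pdr uz r z)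
      (F' := fun r z => (ur r z * pdr ur r z + uθ r z * pdr uθ r z + uz r z * pdr uz r z)
        + (V r z * pdr uz r z + U r z * pdr (pdr uz) r z))
      (by fun_prop) (by fun_prop) ?_ _ _ r
    intro r z
    have a1 := hasDerivAt_pdr hur r z
    have t1 := hasDerivAt_pdr huθ r z
    have z1 := hasDerivAt_pdr huz r z
    have z2 := hasDerivAt_pdr sZr r z
    have := ((((a1.pow 2).add (t1.pow 2)).add (z1.pow 2)).div_const 2).add ((dU r z).mul z2)
    refine this.congr_deriv ?_
    push_cast
    ring
  -- the L² bounds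
  set PP : ℝ := (2 * π) ^ 2 with hPP
  have hPPp : 0 < PP := by positivity
  have bAz : ∀ r, ∫ z in (-π)..π, pdz ur r z ^ 2 ≤ D r := by
    intro r
    refine intervalIntegral.integral_mono_on hpp (Continuous.intervalIntegrable (by fun_prop) _ _)
      ((cE r).intervalIntegrable _ _) fun z _ => ?_
    unfold dirE
    have : 0 ≤ ((ur r z) ^ 2 + (uθ r z) ^ 2) / r ^ 2 := by positivity
    nlinarith [sq_nonneg (pdr ur r z), sq_nonneg (pdr uθ r z), sq_nonneg (pdz uθ r z),
      sq_nonneg (pdr uz r z), sq_nonneg (pdz uz r z)]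
  have bAr : ∀ r, ∫ z in (-π)..π, pdr ur r z ^ 2 ≤ D r := by
    intro r
    refine intervalIntegral.integral_mono_on hpp (Continuous.intervalIntegrable (by fun_prop) _ _)
      ((cE r).intervalIntegrable _ _) fun z _ => ?_
    unfold dirE
    have : 0 ≤ ((ur r z) ^ 2 + (uθ r z) ^ 2) / r ^ 2 := by positivity
    nlinarith [sq_nonneg (pdz ur r z), sq_nonneg (pdr uθ r z), sq_nonneg (pdz uθ r z),
      sq_nonneg (pdr uz r z), sq_nonneg (pdz uz r z)]
  have bA : ∀ r, 0 < r → ∫ z in (-π)..π, ur r z ^ 2 ≤ PP * D r := by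
    intro r hr
    refine (poincare (hasDerivAt_pdz hur r) (by fun_prop) (hmean r hr)).trans ?_
    gcongr
    exact bAz r
  have bU : ∀ r, 0 < r → ∫ z in (-π)..π, U r z ^ 2 ≤ PP * (PP * D r) := by
    intro r hr
    refine (int_sq_prim_le (f := fun z => ur r z) (by fun_prop)).trans ?_
    gcongr
    exact bA r hr
  have bV : ∀ r, ∫ z in (-π)..π, V r z ^ 2 ≤ PP * D r := by
    intro r
    refine (int_sq_prim_le (f := fun z => pdr ur r z) (by fun_prop)).trans ?_
    gcongr
    exact bAr r
  obtain ⟨R1, hR1⟩ := hdecay 1 one_pos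
  set R0 := max 1 R1 with hR0
  have hbd : ∀ r, R0 ≤ r → ∀ z, |ur r z| ≤ 1 ∧ |uθ r z| ≤ 1 ∧ |uz r z| ≤ 1 := by
    intro r hr z
    have := hR1 r ((le_max_right _ _).trans hr) z
    have := abs_nonneg (ur r z)
    have := abs_nonneg (uθ r z)
    have := abs_nonneg (uz r z)
    refine ⟨?_, ?_, ?_⟩ <;> linarith
  set C : ℝ := 2 * (PP * PP) + PP + 2 with hC
  -- key inequality
  have fourInt : ∀ (r α β γ δ : ℝ),
      ∫ z in (-π)..π, (α * U r z ^ 2 + β * V r z ^ 2 + γ * ur r z ^ 2 + δ * dirE ur uθ uz r z)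
      = α * (∫ z in (-π)..π, U r z ^ 2) + β * (∫ z in (-π)..π, V r z ^ 2)
        + γ * (∫ z in (-π)..π, ur r z ^ 2) + δ * D r := by
    intro r α β γ δ
    have := cE r
    rw [intervalIntegral.integral_add, intervalIntegral.integral_add,
      intervalIntegral.integral_add]
    · simp only [intervalIntegral.integral_const_mul, hDdef]
    all_goals exact Continuous.intervalIntegrable (by fun_prop) _ _
  have hin : ∀ r, R0 ≤ r → G r / r ≤ n' r + C * D r := by
    intro r hr
    have hr1 : 1 ≤ r := (le_max_left _ _).trans hr
    have hr0 : 0 < r := by linarith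
    set S : ℝ → ℝ := fun z => U r z * (ur r z * pdz ur r z + uθ r z * pdz uθ r z
      + pdr uz r z / r - ur r z * pdr uz r z) - V r z * pdr uz r z - ur r z * pdz uz r z with hS
    have cS : Continuous S := by simp only [hS, div_eq_mul_inv]; fun_prop
    have hSle : ∫ z in (-π)..π, S z ≤ C * D r := by
      have h1 : ∫ z in (-π)..π, S z ≤ ∫ z in (-π)..π, (2 * U r z ^ 2 + 1 / 2 * V r z ^ 2
          + 1 / 2 * ur r z ^ 2 + 2 * dirE ur uθ uz r z) := by
        have := cE r
        refine intervalIntegral.integral_mono_on hpp (cS.intervalIntegrable _ _)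
          (Continuous.intervalIntegrable (by fun_prop) _ _) fun z _ => ?_
        obtain ⟨bA, bT, bZ⟩ := hbd r hr z
        have key : ∀ x y c : ℝ, |c| ≤ 1 → x * (c * y) ≤ (x ^ 2 + y ^ 2) / 2 := by
          intro x y c hc
          have h1 : c ^ 2 ≤ 1 := (sq_le_one_iff_abs_le_one c).2 hc
          nlinarith [sq_nonneg (c * x - y), mul_nonneg (sub_nonneg.2 h1) (sq_nonneg x)]
        have hri : |r⁻¹| ≤ 1 := by
          rw [abs_of_pos (by positivity)]; exact inv_le_one_of_one_le₀ hr1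
        have k1 := key (U r z) (pdz ur r z) (ur r z) bA
        have k2 := key (U r z) (pdz uθ r z) (uθ r z) bT
        have k3 := key (U r z) (pdr uz r z) r⁻¹ hri
        have k4 := key (U r z) (pdr uz r z) (-ur r z) (by rwa [abs_neg])
        have k5 := key (V r z) (pdr uz r z) (-1) (by simp)
        have k6 := key (ur r z) (pdz uz r z) (-1) (by simp)
        have e : S z = U r z * (ur r z * pdz ur r z) + U r z * (uθ r z * pdz uθ r z)
          + U r z * (r⁻¹ * pdr uz r z) + U r z * (-ur r z * pdr uz r z)
          + V r z * (-1 * pdr uz r z) + ur r z * (-1 * pdz uz r z) := by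
          simp only [hS]; ring
        have hd : 2 * dirE ur uθ uz r z = 2 * ((pdr ur r z) ^ 2 + (pdz ur r z) ^ 2
            + (pdr uθ r z) ^ 2 + (pdz uθ r z) ^ 2 + (pdr uz r z) ^ 2 + (pdz uz r z) ^ 2
            + ((ur r z) ^ 2 + (uθ r z) ^ 2) / r ^ 2) := rfl
        have : 0 ≤ ((ur r z) ^ 2 + (uθ r z) ^ 2) / r ^ 2 := by positivity
        have := sq_nonneg (pdr ur r z)
        have := sq_nonneg (pdz ur r z)
        have := sq_nonneg (pdr uθ r z)
        have := sq_nonneg (pdz uθ r z)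
        have := sq_nonneg (pdr uz r z)
        have := sq_nonneg (pdz uz r z)
        linarith
      rw [fourInt] at h1
      have := bU r hr0
      have := bV r
      have := bA r hr0
      have : C * D r = 2 * (PP * (PP * D r)) + 1 / 2 * (PP * D r) + 1 / 2 * (PP * D r)
        + 2 * D r := by rw [hC]; ring
      linarith
    have i1 := ibp_prim (f := fun z => ur r z)
      (g := fun z => (ur r z ^ 2 + uθ r z ^ 2 + uz r z ^ 2) / 2 + p r z)
      (g' := fun z => ur r z * pdz ur r z + uθ r z * pdz uθ r z + uz r z * pdz uz r z + pdz p r z)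
      (by fun_prop) (by
        intro z
        have a1 := hasDerivAt_pdz hur r z
        have t1 := hasDerivAt_pdz huθ r z
        have z1 := hasDerivAt_pdz huz r z
        have p1 := hasDerivAt_pdz hp r z
        have := ((((a1.pow 2).add (t1.pow 2)).add (z1.pow 2)).div_const 2).add p1
        refine this.congr_deriv ?_
        push_cast
        ring) (by fun_prop) (hmean r hr0)
    have i2 := ibp_prim (f := fun z => ur r z) (g := fun z => pdz uz r z)
      (g' := fun z => pdz (pdz uz) r z)
      (by fun_prop) (hasDerivAt_pdz sZz r) (by fun_prop) (hmean r hr0)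
    have hGr : G r / r = ∫ z in (-π)..π, g r z := by
      simp only [hGdef, intervalIntegral.integral_const_mul]
      field_simp
    have hpt : ∀ z, g r z = ((ur r z * pdr ur r z + uθ r z * pdr uθ r z + uz r z * pdr uz r z)
        + (V r z * pdr uz r z + U r z * pdr (pdr uz) r z)) + S z
        - ur r z * ((ur r z ^ 2 + uθ r z ^ 2 + uz r z ^ 2) / 2 + p r z)
        - U r z * (ur r z * pdz ur r z + uθ r z * pdz uθ r z + uz r z * pdz uz r z + pdz p r z)
        + ur r z * pdz uz r z + U r z * pdz (pdz uz) r z := by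
      intro z
      have e3 := (heq r hr0 z (Set.mem_univ z)).2.2.1
      simp only [hg, hS]
      linear_combination (U r z) * e3
    have hGeq : G r / r = n' r + ∫ z in (-π)..π, S z := by
      rw [hGr]
      simp only [hpt]
      rw [intervalIntegral.integral_add, intervalIntegral.integral_add,
        intervalIntegral.integral_sub, intervalIntegral.integral_sub,
        intervalIntegral.integral_add, i1, i2]
      · simp only [hn', hU]; ring
      all_goals exact Continuous.intervalIntegrable (by fun_prop) _ _
    linarith
  have hnb : ∀ r, R0 ≤ r → n r ≤ 3 * π + C * D r := by
    intro r hr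
    have hr1 : 1 ≤ r := (le_max_left _ _).trans hr
    have hr0 : 0 < r := by linarith
    have h1 : n r ≤ ∫ z in (-π)..π, (3 / 2 + (1 / 2 * U r z ^ 2 + 0 * V r z ^ 2
        + 0 * ur r z ^ 2 + 1 / 2 * dirE ur uθ uz r z)) := by
      have := cE r
      refine intervalIntegral.integral_mono_on hpp (Continuous.intervalIntegrable (by fun_prop) _ _)
        (Continuous.intervalIntegrable (by fun_prop) _ _) fun z _ => ?_
      obtain ⟨bA, bT, bZ⟩ := hbd r hr z
      have h1 := (sq_le_one_iff_abs_le_one _).2 bA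
      have h2 := (sq_le_one_iff_abs_le_one _).2 bT
      have h3 := (sq_le_one_iff_abs_le_one _).2 bZ
      have hd : dirE ur uθ uz r z = ((pdr ur r z) ^ 2 + (pdz ur r z) ^ 2
          + (pdr uθ r z) ^ 2 + (pdz uθ r z) ^ 2 + (pdr uz r z) ^ 2 + (pdz uz r z) ^ 2
          + ((ur r z) ^ 2 + (uθ r z) ^ 2) / r ^ 2) := rfl
      have : 0 ≤ ((ur r z) ^ 2 + (uθ r z) ^ 2) / r ^ 2 := by positivity
      have := sq_nonneg (pdr ur r z)
      have := sq_nonneg (pdz ur r z)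
      have := sq_nonneg (pdr uθ r z)
      have := sq_nonneg (pdz uθ r z)
      have := sq_nonneg (pdz uz r z)
      have := sq_nonneg (U r z - pdr uz r z)
      linarith
    have := cE r
    rw [intervalIntegral.integral_add (Continuous.intervalIntegrable (by fun_prop) _ _)
      (Continuous.intervalIntegrable (by fun_prop) _ _), fourInt, intervalIntegral.integral_const,
      smul_eq_mul] at h1
    have h2 := bU r hr0
    have h3 := hDnn r
    have : C * D r = 2 * (PP * (PP * D r)) + PP * D r + 2 * D r := by rw [hC]; ring
    have : 0 ≤ PP * D r := by positivity
    have : 0 ≤ PP * (PP * D r) := by positivity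
    linarith
  have hDz : ∀ r, 0 < r → D r = 0 :=
    finish (le_max_left 1 R1) (by positivity) hGc hG0 hG (fun r _ => hDnn r) dn hin hnb
      (fun r hr => hGb r ((le_max_left 1 R1).trans hr))
  -- conclusion
  have hEz : ∀ r, 0 < r → ∀ z ∈ Set.Icc (-π) π, dirE ur uθ uz r z = 0 := by
    intro r hr z hz
    by_contra hne
    have hpos : 0 < dirE ur uθ uz r z := lt_of_le_of_ne (nE r z) (Ne.symm hne)
    have := intervalIntegral.integral_pos (by linarith : -π < π) (cE r).continuousOn
      (fun x _ => nE r x) ⟨z, hz, hpos⟩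
    exact this.ne' (hDz r hr)
  have hzero : ∀ r, 0 < r → ∀ z ∈ Set.Icc (-π) π,
      ur r z = 0 ∧ uθ r z = 0 ∧ pdr uz r z = 0 := by
    intro r hr z hz
    have h := hEz r hr z hz
    unfold dirE at h
    have h0 : 0 ≤ ((ur r z) ^ 2 + (uθ r z) ^ 2) / r ^ 2 := by positivity
    have := sq_nonneg (pdr ur r z)
    have := sq_nonneg (pdz ur r z)
    have := sq_nonneg (pdr uθ r z)
    have := sq_nonneg (pdz uθ r z)
    have := sq_nonneg (pdr uz r z)
    have := sq_nonneg (pdz uz r z)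
    have h1 : ((ur r z) ^ 2 + (uθ r z) ^ 2) / r ^ 2 = 0 := by linarith
    have h2 : pdr uz r z ^ 2 = 0 := by linarith
    rw [div_eq_zero_iff] at h1
    have h3 : (ur r z) ^ 2 + (uθ r z) ^ 2 = 0 := by
      rcases h1 with h | h
      · exact h
      · exact absurd h (by positivity)
    have := sq_nonneg (ur r z)
    have := sq_nonneg (uθ r z)
    exact ⟨pow_eq_zero_iff two_ne_zero |>.1 (by linarith),
      pow_eq_zero_iff two_ne_zero |>.1 (by linarith), pow_eq_zero_iff two_ne_zero |>.1 h2⟩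
  have huz0 : ∀ r, 0 < r → ∀ z ∈ Set.Icc (-π) π, uz r z = 0 := by
    intro r hr z hz
    by_contra hne
    obtain ⟨R, hR⟩ := hdecay |uz r z| (abs_pos.2 hne)
    have hk := constant_of_has_deriv_right_zero (f := fun s => uz s z)
      (a := r) (b := max r R) (Continuous.continuousOn (by fun_prop)) (fun x hx => by
        have := (hasDerivAt_pdr huz x z).hasDerivWithinAt (s := Set.Ici x)
        rwa [(hzero x (lt_of_lt_of_le hr hx.1) z hz).2.2] at this)
      (max r R) ⟨le_max_left _ _, le_rfl⟩
    have h1 := hR (max r R) (le_max_right _ _) z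
    rw [hk] at h1
    have := abs_nonneg (ur (max r R) z)
    have := abs_nonneg (uθ (max r R) z)
    linarith
  have hall : ∀ f : ℝ → ℝ → ℝ, Continuous (fun q : ℝ × ℝ => f q.1 q.2) →
      (∀ r z, f r (z + 2 * π) = f r z) → (∀ r, 0 < r → ∀ z ∈ Set.Icc (-π) π, f r z = 0) →
      ∀ r, 0 ≤ r → ∀ z, f r z = 0 := by
    intro f cf pf hf
    have h1 : ∀ r, 0 < r → ∀ z, f r z = 0 := by
      intro r hr z
      obtain ⟨y, hy, hyz⟩ := (show Function.Periodic (f r) (2 * π) from pf r).exists_mem_Ico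
        (by positivity) z (-π)
      rw [hyz]
      exact hf r hr y ⟨hy.1, by linarith [hy.2]⟩
    intro r hr z
    rcases hr.eq_or_lt with h | h
    · subst h
      have hc : Continuous (fun r => f r z) := by fun_prop
      have t1 := (hc.tendsto 0).mono_left (nhdsWithin_le_nhds (s := Set.Ioi 0))
      have t2 : Tendsto (fun r => f r z) (𝓝[>] 0) (𝓝 0) := by
        refine tendsto_const_nhds.congr' ?_
        filter_upwards [self_mem_nhdsWithin] with r hr using (h1 r hr z).symm
      exact tendsto_nhds_unique t1 t2
    · exact h1 r h z
  intro r hr z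
  exact ⟨hall ur cA pA (fun r hr z hz => (hzero r hr z hz).1) r hr z,
    hall uθ cT pT (fun r hr z hz => (hzero r hr z hz).2.1) r hr z,
    hall uz cZ pZ huz0 r hr z⟩
end

section
/- Let u be a smooth axially symmetric solution of the stationary Navier–Stokes system (ASNS) with smooth axially symmetric pressure p on the slab ℝ²×[0,1], satisfying the Dirichlet boundary condition u = 0 at z = 0 and z = 1, u(x) → 0 uniformly as r = |x'| → ∞, and the dyadic Dirichlet bound: there is a constant C_D such that ∫₀¹∫_{R≤r≤2R} |∇u|² r dr dz ≤ C_D for all R ≥ 1. Then u^θ ≡ 0, and there exist a constant C₀ > 0, depending only on C_D, and r₀ ≥ 2 such that |u^r(r,z)| + |u^z(r,z)| ≤ C₀ (ln r / r)^{1/2} for all r ≥ r₀ and z ∈ [0,1]. -/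
open MeasureTheory Real

/-- Joint smoothness of a function of `(r,z)`. -/
def Sm (f : ℝ → ℝ → ℝ) : Prop := ContDiff ℝ (⊤ : ℕ∞) (fun q : ℝ × ℝ => f q.1 q.2)

theorem Sm.hasFD {f : ℝ → ℝ → ℝ} (hf : Sm f) (q : ℝ × ℝ) :
    HasFDerivAt (fun q : ℝ × ℝ => f q.1 q.2) (fderiv ℝ (fun q : ℝ × ℝ => f q.1 q.2) q) q :=
  (ContDiff.differentiable hf (by simp)).differentiableAt.hasFDerivAt

theorem Sm.hr' {f : ℝ → ℝ → ℝ} (hf : Sm f) (r z : ℝ) :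
    HasDerivAt (fun s => f s z) (fderiv ℝ (fun q : ℝ × ℝ => f q.1 q.2) (r, z) (1, 0)) r := by
  have h2 : HasDerivAt (fun s : ℝ => (s, z)) ((1 : ℝ), (0 : ℝ)) r :=
    (hasDerivAt_id r).prodMk (hasDerivAt_const r z)
  exact (hf.hasFD (r, z)).comp_hasDerivAt r h2

theorem Sm.hz' {f : ℝ → ℝ → ℝ} (hf : Sm f) (r z : ℝ) :
    HasDerivAt (fun t => f r t) (fderiv ℝ (fun q : ℝ × ℝ => f q.1 q.2) (r, z) (0, 1)) z := by
  have h2 : HasDerivAt (fun s : ℝ => (r, s)) ((0 : ℝ), (1 : ℝ)) z :=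
    (hasDerivAt_const z r).prodMk (hasDerivAt_id z)
  exact (hf.hasFD (r, z)).comp_hasDerivAt z h2

theorem Sm.pdr_eq {f : ℝ → ℝ → ℝ} (hf : Sm f) (r z : ℝ) :
    pdr f r z = fderiv ℝ (fun q : ℝ × ℝ => f q.1 q.2) (r, z) (1, 0) := (hf.hr' r z).deriv

theorem Sm.pdz_eq {f : ℝ → ℝ → ℝ} (hf : Sm f) (r z : ℝ) :
    pdz f r z = fderiv ℝ (fun q : ℝ × ℝ => f q.1 q.2) (r, z) (0, 1) := (hf.hz' r z).deriv

theorem Sm.hr {f : ℝ → ℝ → ℝ} (hf : Sm f) (r z : ℝ) :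
    HasDerivAt (fun s => f s z) (pdr f r z) r := by
  rw [hf.pdr_eq]; exact hf.hr' r z

theorem Sm.hz {f : ℝ → ℝ → ℝ} (hf : Sm f) (r z : ℝ) :
    HasDerivAt (fun t => f r t) (pdz f r z) z := by
  rw [hf.pdz_eq]; exact hf.hz' r z

theorem Sm.dr {f : ℝ → ℝ → ℝ} (hf : Sm f) : Sm (pdr f) := by
  have h : ContDiff ℝ (⊤ : ℕ∞) (fun q : ℝ × ℝ =>
      fderiv ℝ (fun q : ℝ × ℝ => f q.1 q.2) q (1, 0)) :=
    (ContDiff.fderiv_right hf (by simp)).clm_apply contDiff_const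
  have e : (fun q : ℝ × ℝ => pdr f q.1 q.2) = _ := funext fun q => hf.pdr_eq q.1 q.2
  unfold Sm
  rw [e]
  exact h

theorem Sm.dz {f : ℝ → ℝ → ℝ} (hf : Sm f) : Sm (pdz f) := by
  have h : ContDiff ℝ (⊤ : ℕ∞) (fun q : ℝ × ℝ =>
      fderiv ℝ (fun q : ℝ × ℝ => f q.1 q.2) q (0, 1)) :=
    (ContDiff.fderiv_right hf (by simp)).clm_apply contDiff_const
  have e : (fun q : ℝ × ℝ => pdz f q.1 q.2) = _ := funext fun q => hf.pdz_eq q.1 q.2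
  unfold Sm
  rw [e]
  exact h

theorem Sm.comm {f : ℝ → ℝ → ℝ} (hf : Sm f) (r z : ℝ) :
    pdz (pdr f) r z = pdr (pdz f) r z := by
  have hd : DifferentiableAt ℝ (fderiv ℝ (fun q : ℝ × ℝ => f q.1 q.2)) (r, z) :=
    ((ContDiff.fderiv_right (m := 1) hf
      (by norm_cast)).differentiable (by simp)).differentiableAt
  have hs : IsSymmSndFDerivAt ℝ (fun q : ℝ × ℝ => f q.1 q.2) (r, z) :=
    (ContDiff.contDiffAt hf).isSymmSndFDerivAt (by simp; exact WithTop.coe_le_coe.2 (le_top : (2:ℕ∞) ≤ ⊤))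
  have e1 : (fun q : ℝ × ℝ => pdr f q.1 q.2)
      = fun q => fderiv ℝ (fun q : ℝ × ℝ => f q.1 q.2) q (1, 0) := by
    funext q; exact hf.pdr_eq q.1 q.2
  have e2 : (fun q : ℝ × ℝ => pdz f q.1 q.2)
      = fun q => fderiv ℝ (fun q : ℝ × ℝ => f q.1 q.2) q (0, 1) := by
    funext q; exact hf.pdz_eq q.1 q.2
  rw [hf.dr.pdz_eq, hf.dz.pdr_eq, e1, e2]
  have k1 := (hd.hasFDerivAt.clm_apply (hasFDerivAt_const ((1:ℝ), (0:ℝ)) (r, z))).fderiv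
  have k2 := (hd.hasFDerivAt.clm_apply (hasFDerivAt_const ((0:ℝ), (1:ℝ)) (r, z))).fderiv
  rw [k1, k2]
  simpa using hs (0, 1) (1, 0)

theorem Sm.mul {f g : ℝ → ℝ → ℝ} (hf : Sm f) (hg : Sm g) : Sm (fun r z => f r z * g r z) :=
  ContDiff.mul hf hg
theorem Sm.add {f g : ℝ → ℝ → ℝ} (hf : Sm f) (hg : Sm g) : Sm (fun r z => f r z + g r z) :=
  ContDiff.add hf hg
theorem Sm.sub {f g : ℝ → ℝ → ℝ} (hf : Sm f) (hg : Sm g) : Sm (fun r z => f r z - g r z) :=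
  ContDiff.sub hf hg
theorem Sm.neg {f : ℝ → ℝ → ℝ} (hf : Sm f) : Sm (fun r z => - f r z) :=
  ContDiff.neg hf
theorem Sm.cont {f : ℝ → ℝ → ℝ} (hf : Sm f) : Continuous (fun q : ℝ × ℝ => f q.1 q.2) :=
  ContDiff.continuous hf

/-- Divergence theorem with fluxes vanishing on the boundary. -/
theorem div_flux {P Q : ℝ → ℝ → ℝ} (hP : Sm P) (hQ : Sm Q) {c d : ℝ} (hcd : c ≤ d)
    (hPc : ∀ z, P c z = 0) (hQ0 : ∀ r ∈ Set.Icc c d, Q r 0 = 0)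
    (hQ1 : ∀ r ∈ Set.Icc c d, Q r 1 = 0) :
    ∫ q in Set.Icc ((c, 0) : ℝ × ℝ) (d, 1), (pdr P q.1 q.2 + pdz Q q.1 q.2)
      = ∫ z in (0:ℝ)..1, P d z := by
  have H := integral_divergence_prod_Icc_of_hasFDerivAt_off_countable_of_le
    (fun q : ℝ × ℝ => P q.1 q.2) (fun q : ℝ × ℝ => Q q.1 q.2)
    (fderiv ℝ (fun q : ℝ × ℝ => P q.1 q.2)) (fderiv ℝ (fun q : ℝ × ℝ => Q q.1 q.2))
    (c, 0) (d, 1) ⟨hcd, zero_le_one⟩ ∅ Set.countable_empty hP.cont.continuousOn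
    hQ.cont.continuousOn (fun x _ => hP.hasFD x) (fun x _ => hQ.hasFD x)
  have e : (fun q : ℝ × ℝ => pdr P q.1 q.2 + pdz Q q.1 q.2) = fun x =>
      fderiv ℝ (fun q : ℝ × ℝ => P q.1 q.2) x (1, 0)
        + fderiv ℝ (fun q : ℝ × ℝ => Q q.1 q.2) x (0, 1) := by
    funext q
    rw [hP.pdr_eq, hQ.pdz_eq]
  rw [e, H]
  · have i1 : ∫ x in c..d, Q x 1 = 0 := by
      rw [intervalIntegral.integral_congr (g := fun _ => (0:ℝ))]
      · simp
      · intro x hx; rw [Set.uIcc_of_le hcd] at hx; exact hQ1 x hx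
    have i0 : ∫ x in c..d, Q x 0 = 0 := by
      rw [intervalIntegral.integral_congr (g := fun _ => (0:ℝ))]
      · simp
      · intro x hx; rw [Set.uIcc_of_le hcd] at hx; exact hQ0 x hx
    simp only [i1, i0, hPc]
    simp
  · rw [← e]
    exact ((hP.dr.cont.add hQ.dz.cont).continuousOn).integrableOn_compact isCompact_Icc

/-- Second-derivative test, necessary condition. -/
theorem snd_deriv_le {f f' : ℝ → ℝ} {x m : ℝ} (hf : ∀ y, HasDerivAt f (f' y) y)
    (hf' : HasDerivAt f' m x) (hmax : IsLocalMax f x) : m ≤ 0 := by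
  by_contra hm
  push Not at hm
  have hd : deriv f = f' := funext fun y => (hf y).deriv
  have h0 : f' x = 0 := by rw [← hd]; exact hmax.deriv_eq_zero
  have hmin : IsLocalMin f x := by
    apply isLocalMin_of_deriv_deriv_pos
    · rw [hd, hf'.deriv]; exact hm
    · rw [hd]; exact h0
    · exact (hf x).continuousAt
  have hc : f =ᶠ[nhds x] fun _ => f x := by
    filter_upwards [hmin, hmax] with y h1 h2
    exact le_antisymm h2 h1
  have h3 : deriv f =ᶠ[nhds x] fun _ => 0 := by
    have := hc.deriv
    simpa using this
  have h4 : deriv (deriv f) x = 0 := by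
    rw [h3.deriv_eq]; simp
  rw [hd, hf'.deriv] at h4
  linarith

/-- Weak maximum principle on a rectangle. -/
theorem max_principle {G : ℝ → ℝ → ℝ} (hG : Sm G) {R : ℝ}
    (h0 : ∀ z ∈ Set.Icc (0:ℝ) 1, G 0 z ≤ 0) (hR : ∀ z ∈ Set.Icc (0:ℝ) 1, G R z ≤ 0)
    (hz0 : ∀ r, 0 ≤ r → G r 0 ≤ 0) (hz1 : ∀ r, 0 ≤ r → G r 1 ≤ 0)
    (hinner : ∀ r z, 0 < r → z ∈ Set.Ioo (0:ℝ) 1 → pdr G r z = 0 → pdz G r z = 0 →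
      0 < pdr (pdr G) r z + pdz (pdz G) r z) :
    ∀ r ∈ Set.Icc 0 R, ∀ z ∈ Set.Icc (0:ℝ) 1, G r z ≤ 0 := by
  intro r hr z hz
  obtain ⟨⟨x, y⟩, hxy, hmax⟩ := (isCompact_Icc (a := (0:ℝ)) (b := R)).prod
    (isCompact_Icc (a := (0:ℝ)) (b := 1)) |>.exists_isMaxOn ⟨(r, z), hr, hz⟩ hG.cont.continuousOn
  have hle : ∀ r ∈ Set.Icc 0 R, ∀ z ∈ Set.Icc (0:ℝ) 1, G r z ≤ G x y :=
    fun r hr z hz => hmax (Set.mk_mem_prod hr hz)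
  refine (hle r hr z hz).trans ?_
  obtain ⟨hx, hy⟩ := hxy
  simp only at hx hy
  by_contra hpos
  push Not at hpos
  have hx0 : 0 < x := by
    rcases hx.1.lt_or_eq with h | h
    · exact h
    · subst h; linarith [h0 y hy]
  have hxR : x < R := by
    rcases hx.2.lt_or_eq with h | h
    · exact h
    · subst h; linarith [hR y hy]
  have hy0 : 0 < y := by
    rcases hy.1.lt_or_eq with h | h
    · exact h
    · subst h; linarith [hz0 x hx0.le]
  have hy1 : y < 1 := by
    rcases hy.2.lt_or_eq with h | h
    · exact h
    · subst h; linarith [hz1 x hx0.le]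
  have m1 : IsLocalMax (fun s => G s y) x := by
    filter_upwards [Icc_mem_nhds hx0 hxR] with s hs
    exact hle s hs y hy
  have m2 : IsLocalMax (fun t => G x t) y := by
    filter_upwards [Icc_mem_nhds hy0 hy1] with s hs
    exact hle x hx s hs
  have d1 : pdr G x y = 0 := m1.deriv_eq_zero
  have d2 : pdz G x y = 0 := m2.deriv_eq_zero
  have s1 := snd_deriv_le (fun s => hG.hr s y) (hG.dr.hr x y) m1
  have s2 := snd_deriv_le (fun s => hG.hz x s) (hG.dz.hz x y) m2
  linarith [hinner x y hx0 ⟨hy0, hy1⟩ d1 d2]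

theorem swirl_le {a f b : ℝ → ℝ → ℝ} {V : ℝ} (hV : 0 ≤ V) (hf : Sm f)
    (ha : ∀ r, 0 ≤ r → ∀ z ∈ Set.Icc (0:ℝ) 1, |a r z| ≤ V)
    (hb : ∀ r, 0 ≤ r → ∀ z ∈ Set.Icc (0:ℝ) 1, |b r z| ≤ V)
    (heq : ∀ r, 0 < r → ∀ z ∈ Set.Icc (0:ℝ) 1,
      (a r z * pdr f r z + b r z * pdz f r z) + a r z * f r z / r
        = pdr (pdr f) r z + (1 / r) * pdr f r z + pdz (pdz f) r z - f r z / r ^ 2)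
    (hf0 : ∀ r, f r 0 = 0) (hf1 : ∀ r, f r 1 = 0)
    (hdec : ∀ ε : ℝ, 0 < ε → ∃ R : ℝ, ∀ r : ℝ, R ≤ r → ∀ z ∈ Set.Icc (0:ℝ) 1, f r z < ε) :
    ∀ r, 0 < r → ∀ z ∈ Set.Icc (0:ℝ) 1, f r z ≤ 0 := by
  intro r hr z hz
  set K : ℝ := V + 1 with hK
  set E2 : ℝ := Real.exp (2 * K) with hE2
  set L : ℝ := V * E2 with hL
  have hE2p : 0 < E2 := Real.exp_pos _
  have hLp : 0 ≤ L := by positivity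
  have hKp : 1 ≤ K := by linarith
  have hexp1 : ∀ t ∈ Set.Icc (0:ℝ) 1, Real.exp (K * t) ≤ Real.exp K := by
    intro t ht
    apply Real.exp_le_exp.2
    nlinarith [ht.1, ht.2]
  have hexp0 : ∀ t ∈ Set.Icc (0:ℝ) 1, 1 ≤ Real.exp (K * t) := by
    intro t ht
    apply Real.one_le_exp
    have := ht.1
    positivity
  have hEK : Real.exp K < E2 := Real.exp_lt_exp.2 (by linarith)
  have key : ∀ η : ℝ, 0 < η → r * f r z ≤ η * ((L + r) * E2) := by
    intro η hη
    obtain ⟨R0, hR0⟩ := hdec (η * (E2 - Real.exp K)) (mul_pos hη (by linarith))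
    set R := max R0 r with hRdef
    have hRr : r ≤ R := le_max_right _ _
    have hRp : 0 < R := hr.trans_le hRr
    set G : ℝ → ℝ → ℝ := fun r z => r * f r z - η * ((L + r) * (E2 - Real.exp (K * z))) with hG
    have hGs : Sm G := by
      have h1 : Sm (fun r _ => r) := by unfold Sm; fun_prop
      have h2 : Sm (fun r z => η * ((L + r) * (E2 - Real.exp (K * z)))) := by
        unfold Sm; fun_prop
      exact (h1.mul hf).sub h2
    have hphi : ∀ t ∈ Set.Icc (0:ℝ) 1, 0 < E2 - Real.exp (K * t) := by
      intro t ht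
      linarith [hexp1 t ht]
    have gr : ∀ r z, pdr G r z
        = f r z + r * pdr f r z - η * (E2 - Real.exp (K * z)) := by
      intro r z
      have h1 := ((hasDerivAt_id r).mul (hf.hr r z)).sub
        ((((hasDerivAt_id r).const_add L).mul_const (E2 - Real.exp (K * z))).const_mul η)
      have h2 : HasDerivAt (fun s => G s z) _ r := h1
      rw [pdr, h2.deriv]
      simp
    have grr : ∀ r z, pdr (pdr G) r z = 2 * pdr f r z + r * pdr (pdr f) r z := by
      intro r z
      have e : pdr G = fun r z => f r z + r * pdr f r z - η * (E2 - Real.exp (K * z)) :=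
        funext fun r => funext fun z => gr r z
      have h1 := ((hf.hr r z).add ((hasDerivAt_id r).mul (hf.dr.hr r z))).sub_const
        (η * (E2 - Real.exp (K * z)))
      rw [e]
      exact h1.deriv.trans (by simp; ring)
    have hex : ∀ z, HasDerivAt (fun t => Real.exp (K * t)) (K * Real.exp (K * z)) z := by
      intro z
      have := ((hasDerivAt_id z).const_mul K).exp
      simpa [mul_comm] using this
    have gz : ∀ r z, pdz G r z = r * pdz f r z + η * ((L + r) * (K * Real.exp (K * z))) := by
      intro r z
      have h1 := ((hf.hz r z).const_mul r).sub
        ((((hex z).const_sub E2).const_mul (L + r)).const_mul η)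
      have h2 : HasDerivAt (fun s => G r s) _ z := h1
      rw [pdz, h2.deriv]
      ring
    have gzz : ∀ r z, pdz (pdz G) r z
        = r * pdz (pdz f) r z + η * ((L + r) * (K * (K * Real.exp (K * z)))) := by
      intro r z
      have e : pdz G = fun r z => r * pdz f r z + η * ((L + r) * (K * Real.exp (K * z))) :=
        funext fun r => funext fun z => gz r z
      have h1 := ((hf.dz.hz r z).const_mul r).add
        ((((hex z).const_mul K).const_mul (L + r)).const_mul η)
      rw [e]
      exact h1.deriv
    have hmain := max_principle hGs (R := R) ?_ ?_ ?_ ?_ ?_ r ⟨hr.le, hRr⟩ z hz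
    · have h1 : r * f r z ≤ η * ((L + r) * (E2 - Real.exp (K * z))) := by
        simp only [hG] at hmain; linarith
      refine h1.trans ?_
      have := Real.exp_pos (K * z)
      gcongr
      linarith
    · intro t ht
      have := hphi t ht
      simp only [hG]
      have : 0 ≤ η * ((L + 0) * (E2 - Real.exp (K * t))) := by positivity
      linarith
    · intro t ht
      have h1 := hR0 R (le_max_left _ _) t ht
      have h2 := hexp1 t ht
      have h3 := hphi t ht
      simp only [hG]
      have h4 : R * f R t ≤ R * (η * (E2 - Real.exp (K * t))) := by
        apply mul_le_mul_of_nonneg_left _ hRp.le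
        refine h1.le.trans ?_
        gcongr
      have h5 : 0 ≤ η * (L * (E2 - Real.exp (K * t))) := by positivity
      nlinarith
    · intro t ht
      have := hphi 0 ⟨le_rfl, zero_le_one⟩
      have : 0 ≤ η * ((L + t) * (E2 - Real.exp (K * 0))) := by positivity
      simp only [hG, hf0]
      linarith
    · intro t ht
      have := hphi 1 ⟨zero_le_one, le_rfl⟩
      have : 0 ≤ η * ((L + t) * (E2 - Real.exp (K * 1))) := by positivity
      simp only [hG, hf1]
      linarith
    · intro x y hx hy h1 h2
      have hy' : y ∈ Set.Icc (0:ℝ) 1 := ⟨hy.1.le, hy.2.le⟩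
      rw [gr] at h1
      rw [gz] at h2
      rw [grr, gzz]
      have e := heq x hx y hy'
      have av := abs_le.1 (ha x hx.le y hy')
      have bv := abs_le.1 (hb x hx.le y hy')
      have hp := hphi y hy'
      have he := hexp0 y hy'
      generalize Real.exp (K * y) = X at *
      -- the gradient relations
      have g1 : f x y + x * pdr f x y = η * (E2 - X) := by linarith
      have g2 : x * pdz f x y = - (η * ((L + x) * (K * X))) := by linarith
      have e' : x * pdr (pdr f) x y + x * pdz (pdz f) x y + 2 * pdr f x y
          = (f x y + x * pdr f x y) / x + a x y * (f x y + x * pdr f x y)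
            + b x y * (x * pdz f x y) := by
        field_simp at e ⊢
        linarith
      rw [g1, g2] at e'
      have q0 : 0 ≤ η * (E2 - X) / x := by positivity
      have q1 : - (η * L) ≤ a x y * (η * (E2 - X)) := by
        have i1 : -V * (η * (E2 - X)) ≤ a x y * (η * (E2 - X)) :=
          mul_le_mul_of_nonneg_right av.1 (by positivity)
        have i2 : 0 ≤ V * (η * X) := by positivity
        rw [hL]
        nlinarith
      have q2 : - (V * (η * ((L + x) * (K * X)))) ≤ b x y * -(η * ((L + x) * (K * X))) := by
        have : b x y * (η * ((L + x) * (K * X))) ≤ V * (η * ((L + x) * (K * X))) :=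
          mul_le_mul_of_nonneg_right bv.2 (by positivity)
        linarith
      have q3 : η * (L + x) ≤ η * ((L + x) * (K * X)) := by
        have : 1 ≤ K * X := by nlinarith
        have h0 : 0 ≤ L + x := by linarith
        have : (L + x) * 1 ≤ (L + x) * (K * X) := by gcongr
        have := mul_le_mul_of_nonneg_left this hη.le
        linarith
      have q4 : η * ((L + x) * (K * (K * X))) = V * (η * ((L + x) * (K * X)))
          + η * ((L + x) * (K * X)) := by rw [hK]; ring
      have q5 : 0 < η * x := by positivity
      nlinarith
  have hle : r * f r z ≤ 0 := by
    by_contra hc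
    push Not at hc
    have hden : 0 < (L + r) * E2 := by positivity
    have := key (r * f r z / (2 * ((L + r) * E2))) (by positivity)
    have e : r * f r z / (2 * ((L + r) * E2)) * ((L + r) * E2) = r * f r z / 2 := by
      field_simp
    rw [e] at this
    linarith
  by_contra hc
  push Not at hc
  have := mul_pos hr hc
  linarith

theorem bounded_of {a : ℝ → ℝ → ℝ} (ha : Sm a)
    (hd : ∃ R : ℝ, ∀ r : ℝ, R ≤ r → ∀ z ∈ Set.Icc (0:ℝ) 1, |a r z| < 1) :
    ∃ V : ℝ, ∀ r, 0 ≤ r → ∀ z ∈ Set.Icc (0:ℝ) 1, |a r z| ≤ V := by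
  obtain ⟨R, hR⟩ := hd
  obtain ⟨C, hC⟩ := ((isCompact_Icc (a := (0:ℝ)) (b := R)).prod
    (isCompact_Icc (a := (0:ℝ)) (b := 1))).exists_bound_of_continuousOn ha.cont.continuousOn
  refine ⟨max C 1, fun r hr z hz => ?_⟩
  rcases le_total R r with h | h
  · exact (hR r h z hz).le.trans (le_max_right _ _)
  · exact (hC (r, z) ⟨⟨hr, h⟩, hz⟩).trans (le_max_left _ _)

theorem swirl_zero {ur uθ uz p : ℝ → ℝ → ℝ} (hr : Sm ur) (hθ : Sm uθ) (hz : Sm uz)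
    (hNS : ASNS ur uθ uz p (Set.Icc 0 1))
    (hbc : ∀ r : ℝ, ur r 0 = 0 ∧ uθ r 0 = 0 ∧ uz r 0 = 0
          ∧ ur r 1 = 0 ∧ uθ r 1 = 0 ∧ uz r 1 = 0)
    (hdec : ∀ ε : ℝ, 0 < ε → ∃ R : ℝ, ∀ r : ℝ, R ≤ r → ∀ z ∈ Set.Icc (0:ℝ) 1,
          |ur r z| + |uθ r z| + |uz r z| < ε) :
    ∀ r : ℝ, 0 ≤ r → ∀ z ∈ Set.Icc (0:ℝ) 1, uθ r z = 0 := by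
  obtain ⟨R, hR⟩ := hdec 1 one_pos
  obtain ⟨V1, hV1⟩ := bounded_of hr ⟨R, fun r h z hz => by
    linarith [hR r h z hz, abs_nonneg (uθ r z), abs_nonneg (uz r z)]⟩
  obtain ⟨V2, hV2⟩ := bounded_of hz ⟨R, fun r h z hz => by
    linarith [hR r h z hz, abs_nonneg (uθ r z), abs_nonneg (ur r z)]⟩
  have hV : 0 ≤ max V1 V2 :=
    (abs_nonneg _).trans ((hV1 0 le_rfl 0 ⟨le_rfl, zero_le_one⟩).trans (le_max_left _ _))
  have ha : ∀ r, 0 ≤ r → ∀ z ∈ Set.Icc (0:ℝ) 1, |ur r z| ≤ max V1 V2 :=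
    fun r h z hz => (hV1 r h z hz).trans (le_max_left _ _)
  have hb : ∀ r, 0 ≤ r → ∀ z ∈ Set.Icc (0:ℝ) 1, |uz r z| ≤ max V1 V2 :=
    fun r h z hz => (hV2 r h z hz).trans (le_max_right _ _)
  have up := swirl_le hV hθ ha hb (fun r h z hz => (hNS r h z hz).2.1)
    (fun r => (hbc r).2.1) (fun r => (hbc r).2.2.2.2.1) (fun ε hε => by
      obtain ⟨R, hR⟩ := hdec ε hε
      refine ⟨R, fun r h z hz => ?_⟩
      linarith [hR r h z hz, abs_nonneg (ur r z), abs_nonneg (uz r z), le_abs_self (uθ r z)])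
  have en : ∀ g : ℝ → ℝ → ℝ, pdr (fun r z => - g r z) = fun r z => - pdr g r z := by
    intro g; funext r z; simp [pdr]
  have ez : ∀ g : ℝ → ℝ → ℝ, pdz (fun r z => - g r z) = fun r z => - pdz g r z := by
    intro g; funext r z; simp [pdz]
  have dn := swirl_le hV hθ.neg ha hb (fun r h z hz => by
      have := (hNS r h z hz).2.1
      simp only [en, ez]
      linear_combination -this)
    (fun r => by simp [(hbc r).2.1]) (fun r => by simp [(hbc r).2.2.2.2.1]) (fun ε hε => by
      obtain ⟨R, hR⟩ := hdec ε hε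
      refine ⟨R, fun r h z hz => ?_⟩
      linarith [hR r h z hz, abs_nonneg (ur r z), abs_nonneg (uz r z), neg_le_abs (uθ r z)])
  have pos : ∀ r : ℝ, 0 < r → ∀ z ∈ Set.Icc (0:ℝ) 1, uθ r z = 0 := by
    intro r h z hz
    have h1 := up r h z hz
    have h2 := dn r h z hz
    linarith
  intro r h z hz
  rcases h.lt_or_eq with h | h
  · exact pos r h z hz
  · subst h
    have hc : Filter.Tendsto (fun s => uθ s z) (nhdsWithin 0 (Set.Ioi 0)) (nhds (uθ 0 z)) :=
      ((hθ.hr 0 z).continuousAt.tendsto).mono_left nhdsWithin_le_nhds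
    have h0 : Filter.Tendsto (fun s => uθ s z) (nhdsWithin 0 (Set.Ioi 0)) (nhds 0) := by
      refine tendsto_const_nhds.congr' ?_
      filter_upwards [self_mem_nhdsWithin] with s hs
      exact (pos s hs z hz).symm
    exact tendsto_nhds_unique hc h0

theorem yg (c x y t u : ℝ) (hc : |c| ≤ 1) (ht : 0 < t) (hu : 4 * t * u = 1) :
    -(t * x ^ 2 + u * y ^ 2) ≤ c * (x * y) := by
  have h1 : |c * (x * y)| ≤ |x| * |y| := by
    rw [abs_mul, abs_mul]
    have : 0 ≤ |x| * |y| := by positivity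
    nlinarith
  have h2 : |x| * |y| ≤ t * x ^ 2 + u * y ^ 2 := by
    have hu' : u = 1 / (4 * t) := by field_simp; linarith
    have e : t * x ^ 2 + u * y ^ 2 - |x| * |y| = (2 * t * |x| - |y|) ^ 2 / (4 * t) := by
      rw [hu', ← sq_abs x, ← sq_abs y]; field_simp; ring
    have : 0 ≤ (2 * t * |x| - |y|) ^ 2 / (4 * t) := by positivity
    linarith
  linarith [neg_le_abs (c * (x * y))]

/-- The pointwise absorption inequality. -/
theorem alg_ineq (arz brz brr bzz ar az br bz a b k m1 m2 ρ : ℝ)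
    (hk0 : 0 ≤ k) (hk1 : k ≤ 1) (hm1 : |m1| ≤ 8) (hm2 : |m2| ≤ 56)
    (hρ0 : 0 ≤ ρ) (hρ1 : ρ ≤ 1) (ha : |a| ≤ 1) (hb : |b| ≤ 1)
    (hzz : bzz = - arz - ρ * az) :
    k ^ 2 * arz ^ 2 + k ^ 2 * brz ^ 2 + k ^ 2 * brr ^ 2 ≤
      2 * (k ^ 2 * brz ^ 2 + (k * m1) * brz * bz + k ^ 2 * brr ^ 2 - k ^ 2 * arz * bzz
        + k ^ 2 * brz ^ 2 + (k * m1) * bz * brz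
        + br * ρ * (k ^ 2 * brr + 2 * (k * m1) * br + (k * m2) * b)
        + brr * (2 * (k * m1) * br + (k * m2) * b)
        + bzz * (2 * (k * m1) * br + (k * m2) * b)
        + (a * ar + b * az) * (k ^ 2 * brz + (k * m1) * bz)
        - (a * br + b * bz) * (k ^ 2 * brr + 2 * (k * m1) * br + (k * m2) * b))
      + 80000 * (ar ^ 2 + az ^ 2 + br ^ 2 + bz ^ 2 + b ^ 2) := by
  subst hzz
  set A := k * arz with hA
  set B := k * brz with hB
  set D := k * brr with hD
  set T := 2 * m1 * br + m2 * b with hT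
  set N1 := a * ar + b * az with hN1
  set N2 := a * br + b * bz with hN2
  have hm1s : m1 ^ 2 ≤ 64 := by
    rw [← sq_abs]; nlinarith [abs_nonneg m1]
  have hm2s : m2 ^ 2 ≤ 3136 := by
    rw [← sq_abs]; nlinarith [abs_nonneg m2]
  have has : a ^ 2 ≤ 1 := by
    rw [← sq_abs]; nlinarith [abs_nonneg a]
  have hbs : b ^ 2 ≤ 1 := by
    rw [← sq_abs]; nlinarith [abs_nonneg b]
  have hTs : T ^ 2 ≤ 6272 * (br ^ 2 + b ^ 2) := by
    have : T ^ 2 ≤ 2 * ((2 * m1 * br) ^ 2 + (m2 * b) ^ 2) := by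
      rw [hT]; nlinarith [sq_nonneg (2 * m1 * br - m2 * b)]
    have h1 : m1 ^ 2 * br ^ 2 ≤ 64 * br ^ 2 := by gcongr
    have h2 : m2 ^ 2 * b ^ 2 ≤ 3136 * b ^ 2 := by gcongr
    nlinarith [sq_nonneg br, sq_nonneg b]
  have hN1s : N1 ^ 2 ≤ 2 * (ar ^ 2 + az ^ 2) := by
    have : N1 ^ 2 ≤ 2 * ((a * ar) ^ 2 + (b * az) ^ 2) := by
      rw [hN1]; nlinarith [sq_nonneg (a * ar - b * az)]
    have h1 : a ^ 2 * ar ^ 2 ≤ 1 * ar ^ 2 := by gcongr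
    have h2 : b ^ 2 * az ^ 2 ≤ 1 * az ^ 2 := by gcongr
    nlinarith
  have hN2s : N2 ^ 2 ≤ 2 * (br ^ 2 + bz ^ 2) := by
    have : N2 ^ 2 ≤ 2 * ((a * br) ^ 2 + (b * bz) ^ 2) := by
      rw [hN2]; nlinarith [sq_nonneg (a * br - b * bz)]
    have h1 : a ^ 2 * br ^ 2 ≤ 1 * br ^ 2 := by gcongr
    have h2 : b ^ 2 * bz ^ 2 ≤ 1 * bz ^ 2 := by gcongr
    nlinarith
  have ck : |k| ≤ 1 := by rw [abs_of_nonneg hk0]; exact hk1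
  have cnk : |-k| ≤ 1 := by rw [abs_neg]; exact ck
  have ckρ : |k * ρ| ≤ 1 := by
    rw [abs_of_nonneg (by positivity)]; nlinarith
  have cnkρ : |-(k * ρ)| ≤ 1 := by rw [abs_neg]; exact ckρ
  have c1 : |(1:ℝ)| ≤ 1 := by simp
  have cn1 : |(-1:ℝ)| ≤ 1 := by simp
  have t1 := yg (k * ρ) A az (1/8) 2 ckρ (by norm_num) (by norm_num)
  have t2 := yg 1 B (2 * m1 * bz) (1/2) (1/2) c1 (by norm_num) (by norm_num)
  have t3 := yg (k * ρ) D br (1/8) 2 ckρ (by norm_num) (by norm_num)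
  have t3' := yg (k * ρ) T br (1/2) (1/2) ckρ (by norm_num) (by norm_num)
  have t4 := yg 1 D T (1/8) 2 c1 (by norm_num) (by norm_num)
  have t5 := yg (-1) A T (1/8) 2 cn1 (by norm_num) (by norm_num)
  have t5' := yg (-(k * ρ)) az T (1/2) (1/2) cnkρ (by norm_num) (by norm_num)
  have t6 := yg k B N1 (1/2) (1/2) ck (by norm_num) (by norm_num)
  have t6' := yg k (m1 * bz) N1 (1/2) (1/2) ck (by norm_num) (by norm_num)
  have t7 := yg (-k) D N2 (1/8) 2 cnk (by norm_num) (by norm_num)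
  have t7' := yg (-k) T N2 (1/2) (1/2) cnk (by norm_num) (by norm_num)
  have hmb : (m1 * bz) ^ 2 ≤ 64 * bz ^ 2 := by
    rw [mul_pow]; gcongr
  have e : k ^ 2 * brz ^ 2 + (k * m1) * brz * bz + k ^ 2 * brr ^ 2
        - k ^ 2 * arz * (- arz - ρ * az)
        + k ^ 2 * brz ^ 2 + (k * m1) * bz * brz
        + br * ρ * (k ^ 2 * brr + 2 * (k * m1) * br + (k * m2) * b)
        + brr * (2 * (k * m1) * br + (k * m2) * b)
        + (- arz - ρ * az) * (2 * (k * m1) * br + (k * m2) * b)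
        + N1 * (k ^ 2 * brz + (k * m1) * bz)
        - N2 * (k ^ 2 * brr + 2 * (k * m1) * br + (k * m2) * b)
      = A ^ 2 + 2 * B ^ 2 + D ^ 2 + (k * ρ) * (A * az) + 1 * (B * (2 * m1 * bz))
        + (k * ρ) * (D * br) + (k * ρ) * (T * br) + 1 * (D * T) + (-1) * (A * T)
        + (-(k * ρ)) * (az * T) + k * (B * N1) + k * ((m1 * bz) * N1)
        + (-k) * (D * N2) + (-k) * (T * N2) := by
    rw [hA, hB, hD, hT]; ring
  rw [e]
  have e2 : k ^ 2 * arz ^ 2 + k ^ 2 * brz ^ 2 + k ^ 2 * brr ^ 2 = A ^ 2 + B ^ 2 + D ^ 2 := by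
    rw [hA, hB, hD]; ring
  rw [e2]
  have e3 : (2 * m1 * bz) ^ 2 = 4 * (m1 * bz) ^ 2 := by ring
  rw [e3] at t2
  clear_value A B D T N1 N2
  linarith [sq_nonneg A, sq_nonneg B, sq_nonneg D, sq_nonneg ar, sq_nonneg az, sq_nonneg br,
    sq_nonneg bz, sq_nonneg b]

/-- The cut-off and its derivatives. -/
noncomputable def cH (s r : ℝ) : ℝ := (1 - (r - s) ^ 2) ^ 4
noncomputable def cH1 (s r : ℝ) : ℝ := -8 * (r - s) * (1 - (r - s) ^ 2) ^ 3
noncomputable def cH2 (s r : ℝ) : ℝ :=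
  -8 * (1 - (r - s) ^ 2) ^ 3 + 48 * (r - s) ^ 2 * (1 - (r - s) ^ 2) ^ 2

theorem cH_d (s r : ℝ) : HasDerivAt (cH s) (cH1 s r) r := by
  have h : HasDerivAt (fun r : ℝ => 1 - (r - s) ^ 2) (-(2 * (r - s))) r := by
    have := (((hasDerivAt_id r).sub_const s).pow 2).const_sub 1
    simpa using this
  have h2 := h.pow 4
  exact h2.congr_deriv (by unfold cH1; push_cast; ring)

theorem cH1_d (s r : ℝ) : HasDerivAt (cH1 s) (cH2 s r) r := by
  have h : HasDerivAt (fun r : ℝ => 1 - (r - s) ^ 2) (-(2 * (r - s))) r := by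
    have := (((hasDerivAt_id r).sub_const s).pow 2).const_sub 1
    simpa using this
  have h2 := (((hasDerivAt_id r).sub_const s).const_mul (-8)).mul (h.pow 3)
  exact h2.congr_deriv (by unfold cH2; simp; ring)

theorem cH_sm (s : ℝ) : Sm (fun r _ => cH s r) := by unfold Sm cH; fun_prop
theorem cH1_sm (s : ℝ) : Sm (fun r _ => cH1 s r) := by unfold Sm cH1; fun_prop

/-- r-flux -/
noncomputable def fluxP (s : ℝ) (a b p : ℝ → ℝ → ℝ) (r z : ℝ) : ℝ :=
  pdz p r z * (cH s r * pdr b r z + cH1 s r * b r z)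
    - cH s r * pdz a r z * pdz (pdz b) r z + cH s r * pdz b r z * pdr (pdz b) r z

/-- z-flux -/
noncomputable def fluxQ (s : ℝ) (a b p : ℝ → ℝ → ℝ) (r z : ℝ) : ℝ :=
  cH s r * pdz a r z * pdr (pdz b) r z + cH1 s r * pdz a r z * pdz b r z
    - cH s r * pdz b r z * pdr (pdr b) r z
    - pdr p r z * (cH s r * pdr b r z + cH1 s r * b r z)

theorem fluxP_sm (s : ℝ) {a b p : ℝ → ℝ → ℝ} (ha : Sm a) (hb : Sm b) (hp : Sm p) :
    Sm (fluxP s a b p) :=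
  ((hp.dz.mul (((cH_sm s).mul hb.dr).add ((cH1_sm s).mul hb))).sub
    (((cH_sm s).mul ha.dz).mul hb.dz.dz)).add (((cH_sm s).mul hb.dz).mul hb.dz.dr)

theorem fluxQ_sm (s : ℝ) {a b p : ℝ → ℝ → ℝ} (ha : Sm a) (hb : Sm b) (hp : Sm p) :
    Sm (fluxQ s a b p) :=
  (((((cH_sm s).mul ha.dz).mul hb.dz.dr).add (((cH1_sm s).mul ha.dz).mul hb.dz)).sub
    (((cH_sm s).mul hb.dz).mul hb.dr.dr)).sub
    (hp.dr.mul (((cH_sm s).mul hb.dr).add ((cH1_sm s).mul hb)))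

theorem fluxP_dr (s : ℝ) {a b p : ℝ → ℝ → ℝ} (ha : Sm a) (hb : Sm b) (hp : Sm p) (r z : ℝ) :
    pdr (fluxP s a b p) r z =
      pdr (pdz p) r z * (cH s r * pdr b r z + cH1 s r * b r z)
      + pdz p r z * (cH1 s r * pdr b r z + cH s r * pdr (pdr b) r z
          + (cH2 s r * b r z + cH1 s r * pdr b r z))
      - ((cH1 s r * pdz a r z + cH s r * pdr (pdz a) r z) * pdz (pdz b) r z
          + cH s r * pdz a r z * pdr (pdz (pdz b)) r z)
      + ((cH1 s r * pdz b r z + cH s r * pdr (pdz b) r z) * pdr (pdz b) r z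
          + cH s r * pdz b r z * pdr (pdr (pdz b)) r z) :=
  (((((hp.dz.hr r z).mul (((cH_d s r).mul (hb.dr.hr r z)).add ((cH1_d s r).mul (hb.hr r z))))).sub
    (((cH_d s r).mul (ha.dz.hr r z)).mul (hb.dz.dz.hr r z))).add
    (((cH_d s r).mul (hb.dz.hr r z)).mul (hb.dz.dr.hr r z))).deriv

theorem fluxQ_dz (s : ℝ) {a b p : ℝ → ℝ → ℝ} (ha : Sm a) (hb : Sm b) (hp : Sm p) (r z : ℝ) :
    pdz (fluxQ s a b p) r z =
      (cH s r * pdz (pdz a) r z * pdr (pdz b) r z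
        + cH s r * pdz a r z * pdz (pdr (pdz b)) r z)
      + (cH1 s r * pdz (pdz a) r z * pdz b r z + cH1 s r * pdz a r z * pdz (pdz b) r z)
      - (cH s r * pdz (pdz b) r z * pdr (pdr b) r z
        + cH s r * pdz b r z * pdz (pdr (pdr b)) r z)
      - (pdz (pdr p) r z * (cH s r * pdr b r z + cH1 s r * b r z)
        + pdr p r z * (cH s r * pdz (pdr b) r z + cH1 s r * pdz b r z)) :=
  ((((((ha.dz.hz r z).const_mul (cH s r)).mul (hb.dz.dr.hz r z)).add
    (((ha.dz.hz r z).const_mul (cH1 s r)).mul (hb.dz.hz r z))).sub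
    (((hb.dz.hz r z).const_mul (cH s r)).mul (hb.dr.dr.hz r z))).sub
    ((hp.dr.hz r z).mul (((hb.dr.hz r z).const_mul (cH s r)).add
      ((hb.hz r z).const_mul (cH1 s r))))).deriv

/-- The pointwise energy inequality. -/
theorem pointwise_energy {a b p : ℝ → ℝ → ℝ} (ha : Sm a) (hb : Sm b) (hp : Sm p)
    {s r z : ℝ} (hr : 1 ≤ r) (hs : |r - s| ≤ 1)
    (h1 : a r z * pdr a r z + b r z * pdz a r z + pdr p r z
        = pdr (pdr a) r z + (1 / r) * pdr a r z + pdz (pdz a) r z - a r z / r ^ 2)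
    (h2 : a r z * pdr b r z + b r z * pdz b r z + pdz p r z
        = pdr (pdr b) r z + (1 / r) * pdr b r z + pdz (pdz b) r z)
    (hdr : pdr (pdr a) r z + (1 / r) * pdr a r z - a r z / r ^ 2 + pdr (pdz b) r z = 0)
    (hdz : pdr (pdz a) r z + (1 / r) * pdz a r z + pdz (pdz b) r z = 0)
    (hav : |a r z| ≤ 1) (hbv : |b r z| ≤ 1) :
    cH s r * (pdr (pdz a) r z) ^ 2 + cH s r * (pdr (pdz b) r z) ^ 2
      ≤ 2 * (pdr (fluxP s a b p) r z + pdz (fluxQ s a b p) r z)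
      + 80000 * ((pdr a r z) ^ 2 + (pdz a r z) ^ 2 + (pdr b r z) ^ 2 + (pdz b r z) ^ 2
        + (b r z) ^ 2) := by
  have cb : pdz (pdr b) = pdr (pdz b) := funext fun r => funext fun z => hb.comm r z
  rw [fluxP_dr s ha hb hp, fluxQ_dz s ha hb hp, hp.comm, hb.dz.comm, hb.dr.comm, cb]
  have hx : (r - s) ^ 2 ≤ 1 := by rw [← sq_abs]; nlinarith [abs_nonneg (r - s)]
  have hx0 := sq_nonneg (r - s)
  have K := alg_ineq (pdr (pdz a) r z) (pdr (pdz b) r z) (pdr (pdr b) r z) (pdz (pdz b) r z)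
    (pdr a r z) (pdz a r z) (pdr b r z) (pdz b r z) (a r z) (b r z)
    ((1 - (r - s) ^ 2) ^ 2) (-8 * (r - s) * (1 - (r - s) ^ 2))
    (-8 * (1 - (r - s) ^ 2) + 48 * (r - s) ^ 2) (1 / r) (by positivity) (by nlinarith)
    (by
      rw [abs_mul, abs_mul, abs_of_nonneg (by linarith : 0 ≤ 1 - (r - s) ^ 2)]
      norm_num
      nlinarith [abs_nonneg (r - s)])
    (by rw [abs_le]; constructor <;> linarith)
    (by positivity) (by rw [div_le_one (by linarith)]; exact hr) hav hbv (by linarith)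
  have e0 : cH s r = ((1 - (r - s) ^ 2) ^ 2) ^ 2 := by unfold cH; ring
  have e1 : cH1 s r = (1 - (r - s) ^ 2) ^ 2 * (-8 * (r - s) * (1 - (r - s) ^ 2)) := by
    unfold cH1; ring
  have e2 : cH2 s r = (1 - (r - s) ^ 2) ^ 2 * (-8 * (1 - (r - s) ^ 2) + 48 * (r - s) ^ 2) := by
    unfold cH2; ring
  rw [← e0, ← e1, ← e2] at K
  have hH : 0 ≤ cH s r * (pdr (pdr b) r z) ^ 2 := by rw [e0]; positivity
  have p1 : pdr p r z = pdz (pdz a) r z - pdr (pdz b) r z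
      - (a r z * pdr a r z + b r z * pdz a r z) := by linarith
  have p2 : pdz p r z = pdr (pdr b) r z + (1 / r) * pdr b r z + pdz (pdz b) r z
      - (a r z * pdr b r z + b r z * pdz b r z) := by linarith
  rw [p1, p2]
  refine le_trans ?_ (K.trans (le_of_eq ?_))
  · linarith
  · ring

theorem Sm.intOn {f : ℝ → ℝ → ℝ} (hf : Sm f) (x y : ℝ × ℝ) :
    IntegrableOn (fun q : ℝ × ℝ => f q.1 q.2) (Set.Icc x y) :=
  hf.cont.continuousOn.integrableOn_compact isCompact_Icc

theorem sq_le_slice {f : ℝ → ℝ → ℝ} (hf : Sm f) (s : ℝ) (h0 : f s 0 = 0)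
    (z : ℝ) (hz : z ∈ Set.Icc (0:ℝ) 1) :
    (f s z) ^ 2 ≤ ∫ t in (0:ℝ)..1, (pdz f s t) ^ 2 := by
  set m := f s z with hm
  have hc : Continuous (fun t => pdz f s t) :=
    hf.dz.cont.comp (by fun_prop : Continuous fun t : ℝ => (s, t))
  have ftc : ∫ t in (0:ℝ)..z, pdz f s t = m := by
    rw [intervalIntegral.integral_eq_sub_of_hasDerivAt (fun t _ => hf.hz s t)
      (hc.intervalIntegrable _ _), h0, sub_zero]
  have e : m ^ 2 = ∫ t in (0:ℝ)..z, m * pdz f s t := by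
    rw [intervalIntegral.integral_const_mul, ftc]; ring
  have c2 : Continuous (fun t => ((pdz f s t) ^ 2 + m ^ 2) / 2) := by fun_prop
  have l1 : ∫ t in (0:ℝ)..z, m * pdz f s t ≤ ∫ t in (0:ℝ)..z, ((pdz f s t) ^ 2 + m ^ 2) / 2 := by
    apply intervalIntegral.integral_mono_on hz.1
    · exact (hc.const_mul m).intervalIntegrable _ _
    · exact c2.intervalIntegrable _ _
    · intro t _
      nlinarith [sq_nonneg (pdz f s t - m)]
  have l2 : ∫ t in (0:ℝ)..z, ((pdz f s t) ^ 2 + m ^ 2) / 2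
      ≤ ∫ t in (0:ℝ)..1, ((pdz f s t) ^ 2 + m ^ 2) / 2 := by
    apply intervalIntegral.integral_mono_interval le_rfl hz.1 hz.2
    · filter_upwards with t
      simp only [Pi.zero_apply]
      positivity
    · exact c2.intervalIntegrable _ _
  have l3 : ∫ t in (0:ℝ)..1, ((pdz f s t) ^ 2 + m ^ 2) / 2
      = ((∫ t in (0:ℝ)..1, (pdz f s t) ^ 2) + m ^ 2) / 2 := by
    rw [intervalIntegral.integral_div, intervalIntegral.integral_add]
    · simp
    · exact (hc.pow 2).intervalIntegrable _ _
    · simp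
  linarith

theorem sup_bound {f : ℝ → ℝ → ℝ} (hf : Sm f) (s : ℝ) (h0 : f s 0 = 0)
    (z : ℝ) (hz : z ∈ Set.Icc (0:ℝ) 1) :
    (f s z) ^ 2 ≤ ∫ q in Set.Icc ((s - 1, 0) : ℝ × ℝ) (s + 1, 1),
      (9 * (pdz f q.1 q.2 * pdz f q.1 q.2)
        + cH s q.1 * (pdr (pdz f) q.1 q.2 * pdr (pdz f) q.1 q.2)) := by
  have hfl : Sm (fun r z => cH s r * (pdz f r z * pdz f r z)) :=
    (cH_sm s).mul (hf.dz.mul hf.dz)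
  have hzero : Sm (fun _ _ => (0:ℝ)) := by unfold Sm; fun_prop
  have D := div_flux hfl hzero (c := s - 1) (d := s) (by linarith)
    (fun z => by simp [cH]) (fun _ _ => rfl) (fun _ _ => rfl)
  have e1 : ∫ z in (0:ℝ)..1, cH s s * (pdz f s z * pdz f s z)
      = ∫ t in (0:ℝ)..1, (pdz f s t) ^ 2 := by
    apply intervalIntegral.integral_congr
    intro t _
    simp [cH]; ring
  rw [e1] at D
  have hR : Sm (fun r z => 9 * (pdz f r z * pdz f r z)
        + cH s r * (pdr (pdz f) r z * pdr (pdz f) r z)) := by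
    have h9 : Sm (fun _ _ => (9:ℝ)) := by unfold Sm; fun_prop
    exact (h9.mul (hf.dz.mul hf.dz)).add ((cH_sm s).mul (hf.dz.dr.mul hf.dz.dr))
  refine (sq_le_slice hf s h0 z hz).trans ?_
  rw [← D]
  have hsub : Set.Icc ((s - 1, 0) : ℝ × ℝ) (s, 1) ⊆ Set.Icc (s - 1, 0) (s + 1, 1) :=
    Set.Icc_subset_Icc le_rfl (Prod.mk_le_mk.2 ⟨by linarith, le_rfl⟩)
  have hnn : ∀ r z : ℝ, 0 ≤ 9 * (pdz f r z * pdz f r z)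
        + cH s r * (pdr (pdz f) r z * pdr (pdz f) r z) := by
    intro r z
    have : 0 ≤ cH s r := by
      have : cH s r = ((1 - (r - s) ^ 2) ^ 2) ^ 2 := by unfold cH; ring
      rw [this]; positivity
    have h1 := mul_self_nonneg (pdz f r z)
    have h2 := mul_self_nonneg (pdr (pdz f) r z)
    positivity
  calc _ ≤ ∫ q in Set.Icc ((s - 1, 0) : ℝ × ℝ) (s, 1),
      (9 * (pdz f q.1 q.2 * pdz f q.1 q.2)
        + cH s q.1 * (pdr (pdz f) q.1 q.2 * pdr (pdz f) q.1 q.2)) := by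
        apply setIntegral_mono_on ((hfl.dr.add hzero.dz).intOn _ _) (hR.intOn _ _)
          measurableSet_Icc
        rintro ⟨r, z⟩ hq
        have hr1 : s - 1 ≤ r := hq.1.1
        have hr2 : r ≤ s := hq.2.1
        have d1 : pdr (fun r z => cH s r * (pdz f r z * pdz f r z)) r z
            = cH1 s r * (pdz f r z * pdz f r z) + cH s r * (pdr (pdz f) r z * pdz f r z
              + pdz f r z * pdr (pdz f) r z) :=
          ((cH_d s r).mul ((hf.dz.hr r z).mul (hf.dz.hr r z))).deriv
        have d2 : pdz (fun _ _ => (0:ℝ)) r z = 0 := by simp [pdz]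
        simp only
        rw [d1, d2]
        have hx : (r - s) ^ 2 ≤ 1 := by nlinarith
        have hk0 : 0 ≤ 1 - (r - s) ^ 2 := by linarith
        have hk1 : 1 - (r - s) ^ 2 ≤ 1 := by nlinarith [sq_nonneg (r - s)]
        have b0 : 0 ≤ cH s r := by unfold cH; positivity
        have b1 : cH s r ≤ 1 := by unfold cH; exact pow_le_one₀ hk0 hk1
        have b2 : cH1 s r ≤ 8 := by
          unfold cH1
          have h3 : (1 - (r - s) ^ 2) ^ 3 ≤ 1 := pow_le_one₀ hk0 hk1
          have h4 : 0 ≤ (1 - (r - s) ^ 2) ^ 3 := by positivity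
          nlinarith
        have hs0 := mul_self_nonneg (pdz f r z)
        have y := mul_nonneg b0 (mul_self_nonneg (pdr (pdz f) r z - pdz f r z))
        have y2 := mul_le_mul_of_nonneg_right b2 hs0
        have y3 := mul_le_mul_of_nonneg_right b1 hs0
        nlinarith
    _ ≤ _ := by
        apply setIntegral_mono_set (hR.intOn _ _)
        · filter_upwards with q
          exact hnn q.1 q.2
        · exact Filter.Eventually.of_forall hsub

theorem div_eq_dr {a b : ℝ → ℝ → ℝ} (ha : Sm a) (hb : Sm b) {z : ℝ}
    (h : ∀ r, 0 < r → pdr a r z + a r z / r + pdz b r z = 0) {r : ℝ} (hr : 0 < r) :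
    pdr (pdr a) r z + (1 / r) * pdr a r z - a r z / r ^ 2 + pdr (pdz b) r z = 0 := by
  have h1 : HasDerivAt (fun s => pdr a s z + a s z / s + pdz b s z) _ r :=
    ((ha.dr.hr r z).add ((ha.hr r z).div (hasDerivAt_id r) hr.ne')).add (hb.dz.hr r z)
  have h2 : (fun s => pdr a s z + a s z / s + pdz b s z) =ᶠ[nhds r] fun _ => 0 := by
    filter_upwards [lt_mem_nhds hr] with s hs
    exact h s hs
  have h3 := h1.unique ((hasDerivAt_const r (0:ℝ)).congr_of_eventuallyEq h2)
  simp only [id] at h3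
  rw [← h3]
  field_simp
  ring

theorem div_eq_dz {a b : ℝ → ℝ → ℝ} (ha : Sm a) (hb : Sm b) {r : ℝ}
    (h : ∀ z ∈ Set.Icc (0:ℝ) 1, pdr a r z + a r z / r + pdz b r z = 0)
    {z : ℝ} (hz : z ∈ Set.Icc (0:ℝ) 1) :
    pdr (pdz a) r z + (1 / r) * pdz a r z + pdz (pdz b) r z = 0 := by
  have h1 : HasDerivAt (fun t => pdr a r t + a r t / r + pdz b r t) _ z :=
    ((ha.dr.hz r z).add ((ha.hz r z).div_const r)).add (hb.dz.hz r z)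
  have h2 : HasDerivWithinAt (fun t => pdr a r t + a r t / r + pdz b r t) 0
      (Set.Icc (0:ℝ) 1) z :=
    (hasDerivWithinAt_const z (Set.Icc (0:ℝ) 1) (0:ℝ)).congr h (h z hz)
  have h3 := ((uniqueDiffOn_Icc (zero_lt_one' ℝ)) z hz).eq_deriv _ h1.hasDerivWithinAt h2
  rw [ha.comm] at h3
  rw [← h3]
  ring

theorem int_lin3 {S : Set (ℝ × ℝ)} {f g h : ℝ × ℝ → ℝ} (c d e : ℝ) (hf : IntegrableOn f S)
    (hg : IntegrableOn g S) (hh : IntegrableOn h S) :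
    ∫ q in S, (c * f q + d * g q + e * h q)
      = c * (∫ q in S, f q) + d * (∫ q in S, g q) + e * ∫ q in S, h q := by
  have h12 : IntegrableOn (fun q => c * f q + d * g q) S :=
    (hf.const_mul c).add (hg.const_mul d)
  rw [integral_add h12 (hh.const_mul e), integral_add (hf.const_mul c) (hg.const_mul d),
    integral_const_mul, integral_const_mul, integral_const_mul]

/-- The local energy estimate. -/
theorem local_energy {a b p : ℝ → ℝ → ℝ} (ha : Sm a) (hb : Sm b) (hp : Sm p) {s : ℝ} (hs : 3 ≤ s)
    (h1 : ∀ r, 0 < r → ∀ z ∈ Set.Icc (0:ℝ) 1, a r z * pdr a r z + b r z * pdz a r z + pdr p r z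
        = pdr (pdr a) r z + (1 / r) * pdr a r z + pdz (pdz a) r z - a r z / r ^ 2)
    (h2 : ∀ r, 0 < r → ∀ z ∈ Set.Icc (0:ℝ) 1, a r z * pdr b r z + b r z * pdz b r z + pdz p r z
        = pdr (pdr b) r z + (1 / r) * pdr b r z + pdz (pdz b) r z)
    (hdiv : ∀ r, 0 < r → ∀ z ∈ Set.Icc (0:ℝ) 1, pdr a r z + a r z / r + pdz b r z = 0)
    (ha0 : ∀ r, a r 0 = 0) (ha1 : ∀ r, a r 1 = 0) (hb0 : ∀ r, b r 0 = 0) (hb1 : ∀ r, b r 1 = 0)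
    (hbd : ∀ r, s - 1 ≤ r → ∀ z ∈ Set.Icc (0:ℝ) 1, |a r z| ≤ 1 ∧ |b r z| ≤ 1) :
    ∫ q in Set.Icc ((s - 1, 0) : ℝ × ℝ) (s + 1, 1),
      (cH s q.1 * (pdr (pdz a) q.1 q.2) ^ 2 + cH s q.1 * (pdr (pdz b) q.1 q.2) ^ 2)
    ≤ 160000 * ∫ q in Set.Icc ((s - 1, 0) : ℝ × ℝ) (s + 1, 1),
      ((pdr a q.1 q.2) ^ 2 + (pdz a q.1 q.2) ^ 2 + (pdr b q.1 q.2) ^ 2 + (pdz b q.1 q.2) ^ 2) := by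
  have hP := fluxP_sm s ha hb hp
  have hQ := fluxQ_sm s ha hb hp
  -- boundary facts
  have bd : ∀ t : ℝ, t ∈ Set.Icc (0:ℝ) 1 → (∀ r, a r t = 0) → (∀ r, b r t = 0) →
      ∀ r ∈ Set.Icc (s - 1) (s + 1), fluxQ s a b p r t = 0 := by
    intro t ht hat hbt r hr
    have rp : 0 < r := by linarith [hr.1]
    have ar : ∀ r, pdr a r t = 0 := fun r => by simp [pdr, hat]
    have br : ∀ r, pdr b r t = 0 := fun r => by simp [pdr, hbt]
    have bz : ∀ r, 0 < r → pdz b r t = 0 := by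
      intro r hr
      have := hdiv r hr t ht
      rw [ar, hat] at this
      simpa using this
    have brz : pdr (pdz b) r t = 0 := by
      have : (fun s => pdz b s t) =ᶠ[nhds r] fun _ => 0 := by
        filter_upwards [lt_mem_nhds rp] with s hs
        exact bz s hs
      rw [pdr, this.deriv_eq]; simp
    unfold fluxQ
    rw [brz, bz r rp, br, hbt]
    ring
  have i0 : (0:ℝ) ∈ Set.Icc (0:ℝ) 1 := ⟨le_rfl, zero_le_one⟩
  have i1 : (1:ℝ) ∈ Set.Icc (0:ℝ) 1 := ⟨zero_le_one, le_rfl⟩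
  have F := div_flux hP hQ (c := s - 1) (d := s + 1) (by linarith)
    (fun z => by simp [fluxP, cH, cH1]) (bd 0 i0 ha0 hb0) (bd 1 i1 ha1 hb1)
  have F0 : ∫ z in (0:ℝ)..1, fluxP s a b p (s + 1) z = 0 := by simp [fluxP, cH, cH1]
  rw [F0] at F
  -- Poincare
  have hzero : Sm (fun _ _ => (0:ℝ)) := by unfold Sm; fun_prop
  have hzm : Sm (fun _ z => z - 1 / 2) := by unfold Sm; fun_prop
  have hW : Sm (fun r z => (z - 1 / 2) * (b r z * b r z)) := hzm.mul (hb.mul hb)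
  have F2 := div_flux hzero hW (c := s - 1) (d := s + 1) (by linarith)
    (fun z => rfl) (fun r _ => by simp [hb0]) (fun r _ => by simp [hb1])
  simp only [intervalIntegral.integral_zero] at F2
  have I1 := ((hP.dr.add hQ.dz).intOn (s - 1, 0) (s + 1, 1))
  have I2 := ((hzero.dr.add hW.dz).intOn (s - 1, 0) (s + 1, 1))
  have HE : Continuous (fun q : ℝ × ℝ => (pdr a q.1 q.2) ^ 2 + (pdz a q.1 q.2) ^ 2
      + (pdr b q.1 q.2) ^ 2 + (pdz b q.1 q.2) ^ 2) :=
    (((ha.dr.cont.pow 2).add (ha.dz.cont.pow 2)).add (hb.dr.cont.pow 2)).add (hb.dz.cont.pow 2)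
  have I3 : IntegrableOn (fun q : ℝ × ℝ => (pdr a q.1 q.2) ^ 2 + (pdz a q.1 q.2) ^ 2
      + (pdr b q.1 q.2) ^ 2 + (pdz b q.1 q.2) ^ 2) (Set.Icc (s - 1, 0) (s + 1, 1)) :=
    HE.continuousOn.integrableOn_compact isCompact_Icc
  have HL : Continuous (fun q : ℝ × ℝ => cH s q.1 * (pdr (pdz a) q.1 q.2) ^ 2
      + cH s q.1 * (pdr (pdz b) q.1 q.2) ^ 2) :=
    ((cH_sm s).cont.mul (ha.dz.dr.cont.pow 2)).add ((cH_sm s).cont.mul (hb.dz.dr.cont.pow 2))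
  have J : ∫ q in Set.Icc ((s - 1, 0) : ℝ × ℝ) (s + 1, 1),
      (cH s q.1 * (pdr (pdz a) q.1 q.2) ^ 2 + cH s q.1 * (pdr (pdz b) q.1 q.2) ^ 2)
    ≤ ∫ q in Set.Icc ((s - 1, 0) : ℝ × ℝ) (s + 1, 1),
      (2 * (pdr (fluxP s a b p) q.1 q.2 + pdz (fluxQ s a b p) q.1 q.2)
        + 160000 * (pdr (fun _ _ => (0:ℝ)) q.1 q.2
            + pdz (fun r z => (z - 1 / 2) * (b r z * b r z)) q.1 q.2)
        + 160000 * ((pdr a q.1 q.2) ^ 2 + (pdz a q.1 q.2) ^ 2 + (pdr b q.1 q.2) ^ 2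
            + (pdz b q.1 q.2) ^ 2)) := by
    apply setIntegral_mono_on (HL.continuousOn.integrableOn_compact isCompact_Icc)
      (((I1.const_mul 2).add (I2.const_mul 160000)).add (I3.const_mul 160000)) measurableSet_Icc
    rintro ⟨r, z⟩ hq
    have hr1 : s - 1 ≤ r := hq.1.1
    have hr2 : r ≤ s + 1 := hq.2.1
    have hz : z ∈ Set.Icc (0:ℝ) 1 := ⟨hq.1.2, hq.2.2⟩
    have rp : 0 < r := by linarith
    obtain ⟨hav, hbv⟩ := hbd r hr1 z hz
    have K := pointwise_energy ha hb hp (s := s) (by linarith : 1 ≤ r)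
      (abs_le.2 ⟨by linarith, by linarith⟩) (h1 r rp z hz) (h2 r rp z hz)
      (div_eq_dr ha hb (fun r hr => hdiv r hr z hz) rp)
      (div_eq_dz ha hb (fun z hz => hdiv r rp z hz) hz) hav hbv
    have d0 : pdr (fun _ _ => (0:ℝ)) r z = 0 := by simp [pdr]
    have dW : pdz (fun r z => (z - 1 / 2) * (b r z * b r z)) r z
        = 1 * (b r z * b r z) + (z - 1 / 2) * (pdz b r z * b r z + b r z * pdz b r z) :=
      (((hasDerivAt_id z).sub_const (1 / 2)).mul ((hb.hz r z).mul (hb.hz r z))).deriv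
    have Y := yg (2 * (z - 1 / 2)) (b r z) (pdz b r z) (1/2) (1/2)
      (abs_le.2 ⟨by linarith [hz.1], by linarith [hz.2]⟩) (by norm_num) (by norm_num)
    simp only [Pi.add_apply]
    rw [d0, dW]
    nlinarith [sq_nonneg (pdr a r z), sq_nonneg (pdz a r z), sq_nonneg (pdr b r z)]
  refine J.trans (le_of_eq ?_)
  rw [int_lin3 2 160000 160000 I1 I2 I3, F, F2]
  ring

/-- The Dirichlet integral on a unit-size rectangle. -/
theorem dirichlet_local {a f b : ℝ → ℝ → ℝ} (ha : Sm a) (hb : Sm b) {C s : ℝ}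
    (hs : 3 ≤ s)
    (hD : ∀ R : ℝ, 1 ≤ R →
          ∫⁻ q in Set.Icc R (2 * R) ×ˢ Set.Icc (0:ℝ) 1,
            ENNReal.ofReal (dirE a f b q.1 q.2 * q.1) ≤ ENNReal.ofReal C) :
    (s - 1) * ∫ q in Set.Icc ((s - 1, 0) : ℝ × ℝ) (s + 1, 1),
      ((pdr a q.1 q.2) ^ 2 + (pdz a q.1 q.2) ^ 2 + (pdr b q.1 q.2) ^ 2 + (pdz b q.1 q.2) ^ 2)
      ≤ max C 0 := by
  have HE : Continuous (fun q : ℝ × ℝ => (s - 1) * ((pdr a q.1 q.2) ^ 2 + (pdz a q.1 q.2) ^ 2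
      + (pdr b q.1 q.2) ^ 2 + (pdz b q.1 q.2) ^ 2)) :=
    ((((ha.dr.cont.pow 2).add (ha.dz.cont.pow 2)).add (hb.dr.cont.pow 2)).add
      (hb.dz.cont.pow 2)).const_mul _
  rw [← integral_const_mul]
  rw [← ENNReal.ofReal_le_ofReal_iff (le_max_right _ _),
    ofReal_integral_eq_lintegral_ofReal (HE.continuousOn.integrableOn_compact isCompact_Icc)]
  · refine le_trans ?_ ((hD (s - 1) (by linarith)).trans (ENNReal.ofReal_le_ofReal (le_max_left _ _)))
    have hsub : Set.Icc ((s - 1, 0) : ℝ × ℝ) (s + 1, 1)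
        ⊆ Set.Icc (s - 1) (2 * (s - 1)) ×ˢ Set.Icc (0:ℝ) 1 := by
      rintro ⟨r, z⟩ hq
      have q1 : s - 1 ≤ r := hq.1.1
      have q2 : r ≤ s + 1 := hq.2.1
      exact ⟨⟨q1, by simp only; linarith⟩, ⟨hq.1.2, hq.2.2⟩⟩
    refine le_trans ?_ (lintegral_mono_set hsub)
    apply setLIntegral_mono' measurableSet_Icc
    rintro ⟨r, z⟩ hq
    have q1 : s - 1 ≤ r := hq.1.1
    apply ENNReal.ofReal_le_ofReal
    simp only [dirE]
    have hn : 0 ≤ ((a r z) ^ 2 + (f r z) ^ 2) / r ^ 2 := by positivity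
    rw [mul_comm]
    have h0 : 0 ≤ s - 1 := by linarith
    exact mul_le_mul (by linarith [sq_nonneg (pdr f r z), sq_nonneg (pdz f r z)]) q1 h0 (by positivity)
  · filter_upwards with q
    have h0 : 0 ≤ s - 1 := by linarith
    simp only [Pi.zero_apply]
    positivity

/-- For a smooth axially symmetric solution of ASNS in the slab
`ℝ² × [0,1]` with Dirichlet boundary conditions, uniform decay at spatial infinity and a
dyadic Dirichlet bound `C_D`, the swirl `u^θ` vanishes identically and
`|u^r| + |u^z| ≤ C₀ (ln r / r)^{1/2}` for large `r`, with `C₀` depending only on `C_D`. -/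
theorem slab_swirl_vanishing_and_decay :
    ∀ C_D : ℝ, ∃ C₀ : ℝ, 0 < C₀ ∧
      ∀ ur uθ uz p : ℝ → ℝ → ℝ,
        ContDiff ℝ (⊤ : ℕ∞) (fun q : ℝ × ℝ => ur q.1 q.2) →
        ContDiff ℝ (⊤ : ℕ∞) (fun q : ℝ × ℝ => uθ q.1 q.2) →
        ContDiff ℝ (⊤ : ℕ∞) (fun q : ℝ × ℝ => uz q.1 q.2) →
        ContDiff ℝ (⊤ : ℕ∞) (fun q : ℝ × ℝ => p q.1 q.2) →
        ASNS ur uθ uz p (Set.Icc 0 1) →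
        (∀ r : ℝ, ur r 0 = 0 ∧ uθ r 0 = 0 ∧ uz r 0 = 0
          ∧ ur r 1 = 0 ∧ uθ r 1 = 0 ∧ uz r 1 = 0) →
        (∀ ε : ℝ, 0 < ε → ∃ R : ℝ, ∀ r : ℝ, R ≤ r → ∀ z ∈ Set.Icc (0:ℝ) 1,
          |ur r z| + |uθ r z| + |uz r z| < ε) →
        (∀ R : ℝ, 1 ≤ R →
          ∫⁻ q in Set.Icc R (2 * R) ×ˢ Set.Icc (0:ℝ) 1,
            ENNReal.ofReal (dirE ur uθ uz q.1 q.2 * q.1) ≤ ENNReal.ofReal C_D) →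
        (∀ r : ℝ, 0 ≤ r → ∀ z ∈ Set.Icc (0:ℝ) 1, uθ r z = 0) ∧
          ∃ r₀ : ℝ, 2 ≤ r₀ ∧ ∀ r : ℝ, r₀ ≤ r → ∀ z ∈ Set.Icc (0:ℝ) 1,
            |ur r z| + |uz r z| ≤ C₀ * Real.sqrt (Real.log r / r) := by
  intro C_D
  set M : ℝ := 160009 * max C_D 0 with hM
  have hM0 : 0 ≤ M := by positivity
  refine ⟨2 * Real.sqrt (2 * M) + 1, by positivity, ?_⟩
  intro ur uθ uz p hr hθ hz hp hNS hbc hdec hD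
  have hr' : Sm ur := hr
  have hθ' : Sm uθ := hθ
  have hz' : Sm uz := hz
  have hp' : Sm p := hp
  have sw := swirl_zero hr' hθ' hz' hNS hbc hdec
  refine ⟨sw, ?_⟩
  obtain ⟨R, hR⟩ := hdec 1 one_pos
  refine ⟨max 3 (R + 1), le_trans (by norm_num) (le_max_left _ _), ?_⟩
  intro s hs z hzz
  have hs3 : 3 ≤ s := (le_max_left _ _).trans hs
  have hsR : R + 1 ≤ s := (le_max_right _ _).trans hs
  have LE := local_energy hr' hz' hp' hs3
    (fun r h z hz => by
      have := (hNS r h z hz).1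
      rw [sw r h.le z hz] at this
      simpa using this)
    (fun r h z hz => (hNS r h z hz).2.2.1) (fun r h z hz => (hNS r h z hz).2.2.2)
    (fun r => (hbc r).1) (fun r => (hbc r).2.2.2.1) (fun r => (hbc r).2.2.1)
    (fun r => (hbc r).2.2.2.2.2)
    (fun r h z hz => by
      have := hR r (by linarith) z hz
      constructor <;> linarith [abs_nonneg (ur r z), abs_nonneg (uθ r z), abs_nonneg (uz r z)])
  have DL := dirichlet_local (f := uθ) hr' hz' hs3 hD
  set EI := ∫ q in Set.Icc ((s - 1, 0) : ℝ × ℝ) (s + 1, 1),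
      ((pdr ur q.1 q.2) ^ 2 + (pdz ur q.1 q.2) ^ 2 + (pdr uz q.1 q.2) ^ 2
        + (pdz uz q.1 q.2) ^ 2) with hEI
  have HE : Continuous (fun q : ℝ × ℝ => (pdr ur q.1 q.2) ^ 2 + (pdz ur q.1 q.2) ^ 2
      + (pdr uz q.1 q.2) ^ 2 + (pdz uz q.1 q.2) ^ 2) :=
    (((hr'.dr.cont.pow 2).add (hr'.dz.cont.pow 2)).add (hz'.dr.cont.pow 2)).add
      (hz'.dz.cont.pow 2)
  have HL : Continuous (fun q : ℝ × ℝ => cH s q.1 * (pdr (pdz ur) q.1 q.2) ^ 2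
      + cH s q.1 * (pdr (pdz uz) q.1 q.2) ^ 2) :=
    ((cH_sm s).cont.mul (hr'.dz.dr.cont.pow 2)).add ((cH_sm s).cont.mul (hz'.dz.dr.cont.pow 2))
  have IE := HE.continuousOn.integrableOn_compact (μ := volume)
    (isCompact_Icc (a := ((s - 1, 0) : ℝ × ℝ)) (b := (s + 1, 1)))
  have IL := HL.continuousOn.integrableOn_compact (μ := volume)
    (isCompact_Icc (a := ((s - 1, 0) : ℝ × ℝ)) (b := (s + 1, 1)))
  have hcH : ∀ r, 0 ≤ cH s r := by
    intro r
    have : cH s r = ((1 - (r - s) ^ 2) ^ 2) ^ 2 := by unfold cH; ring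
    rw [this]; positivity
  have h9 : Sm (fun _ _ => (9:ℝ)) := by unfold Sm; fun_prop
  have fin : ∀ f : ℝ → ℝ → ℝ, Sm f → f s 0 = 0 →
      (∀ r z, (pdz f r z) ^ 2 ≤ (pdr ur r z) ^ 2 + (pdz ur r z) ^ 2
        + (pdr uz r z) ^ 2 + (pdz uz r z) ^ 2) →
      (∀ r z, (pdr (pdz f) r z) ^ 2 ≤ (pdr (pdz ur) r z) ^ 2 + (pdr (pdz uz) r z) ^ 2) →
      |f s z| ≤ Real.sqrt (2 * M) * Real.sqrt (Real.log s / s) := by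
    intro f hf hf0 l1 l2
    have S := sup_bound hf s hf0 z hzz
    have S2 : (f s z) ^ 2 ≤ 160009 * EI := by
      refine S.trans ?_
      have : ∫ q in Set.Icc ((s - 1, 0) : ℝ × ℝ) (s + 1, 1),
          (9 * (pdz f q.1 q.2 * pdz f q.1 q.2)
            + cH s q.1 * (pdr (pdz f) q.1 q.2 * pdr (pdz f) q.1 q.2))
          ≤ ∫ q in Set.Icc ((s - 1, 0) : ℝ × ℝ) (s + 1, 1),
          (9 * ((pdr ur q.1 q.2) ^ 2 + (pdz ur q.1 q.2) ^ 2
            + (pdr uz q.1 q.2) ^ 2 + (pdz uz q.1 q.2) ^ 2)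
          + (cH s q.1 * (pdr (pdz ur) q.1 q.2) ^ 2
            + cH s q.1 * (pdr (pdz uz) q.1 q.2) ^ 2)) := by
        apply setIntegral_mono_on _ ((IE.const_mul 9).add IL) measurableSet_Icc
        · rintro ⟨r, z⟩ _
          have y1 := l1 r z
          have y2 := mul_le_mul_of_nonneg_left (l2 r z) (hcH r)
          simp only [Pi.add_apply]
          nlinarith
        · exact ((h9.mul (hf.dz.mul hf.dz)).add
            ((cH_sm s).mul (hf.dz.dr.mul hf.dz.dr))).intOn _ _
      rw [integral_add (IE.const_mul 9) IL, integral_const_mul] at this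
      linarith
    have hs0 : 0 < s := by linarith
    have hlog : 1 ≤ Real.log s := by
      rw [Real.le_log_iff_exp_le hs0]
      linarith [Real.exp_one_lt_d9]
    have hE : EI ≤ 2 * max C_D 0 / s := by
      rw [le_div_iff₀ hs0]
      have : 0 ≤ EI := integral_nonneg fun q => by positivity
      nlinarith
    rw [← Real.sqrt_mul (by positivity)]
    apply Real.abs_le_sqrt
    calc (f s z) ^ 2 ≤ 160009 * EI := S2
      _ ≤ 160009 * (2 * max C_D 0 / s) := by gcongr
      _ = 2 * M * (1 / s) := by rw [hM]; ring
      _ ≤ 2 * M * (Real.log s / s) := by gcongr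
  have A := fin ur hr' (hbc s).1
    (fun r z => by nlinarith [sq_nonneg (pdr ur r z), sq_nonneg (pdr uz r z), sq_nonneg (pdz uz r z)])
    (fun r z => by nlinarith [sq_nonneg (pdr (pdz uz) r z)])
  have B := fin uz hz' (hbc s).2.2.1
    (fun r z => by nlinarith [sq_nonneg (pdr ur r z), sq_nonneg (pdr uz r z), sq_nonneg (pdz ur r z)])
    (fun r z => by nlinarith [sq_nonneg (pdr (pdz ur) r z)])
  have := Real.sqrt_nonneg (Real.log s / s)
  nlinarith
end
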